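/- arXiv:1709.03137 — 2 statements merged into one kernel-verified Lean document; each statement's English description precedes it below -/
import Mathlib

section
/- Let d ≥ 1 and r ≥ d+1. There exists a constant C(d) > 0 such that the following holds for every integer n ≥ 2. Let P ⊆ ℝ^d be a polytope with nonempty interior having at most r vertices, let X_1, …, X_n be i.i.d. points uniformly distributed in P, and let P̂_n^{(r)} be any random polytope with at most r vertices that contains all the points X_1, …, X_n and has minimal volume among all such polytopes (assume a measurable selection so that |P △ P̂_n^{(r)}| is a random variable). Then E_P[|P △ P̂_n^{(r)}| / |P|] ≤ C(d)·r·ln(n)/n. -/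
open MeasureTheory Metric Set
open scoped RealInnerProductSpace ENNReal symmDiff

noncomputable section

abbrev Euc (d : ℕ) := EuclideanSpace ℝ (Fin d)

/-- A convex body: a compact convex set with nonempty interior. -/
def IsConvexBody {d : ℕ} (G : Set (Euc d)) : Prop :=
  IsCompact G ∧ Convex ℝ G ∧ (interior G).Nonempty

/-- The uniform probability measure on `G` (normalized restriction of Lebesgue measure). -/
def unifMeasure {d : ℕ} (G : Set (Euc d)) : Measure (Euc d) :=
  (volume G)⁻¹ • volume.restrict G

instance {d : ℕ} (G : Set (Euc d)) : IsFiniteMeasure (unifMeasure G) := by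
  constructor
  rw [unifMeasure, Measure.smul_apply, Measure.restrict_apply_univ, smul_eq_mul]
  exact (ENNReal.inv_mul_le_one _).trans_lt ENNReal.one_lt_top

/-- Joint distribution of `n` i.i.d. points uniformly distributed in `G`. -/
def sampleMeasure {d : ℕ} (G : Set (Euc d)) (n : ℕ) : Measure (Fin n → Euc d) :=
  Measure.pi fun _ => unifMeasure G

/-- `P` is a polytope with at most `r` vertices. -/
def IsPolytopeWithAtMost {d : ℕ} (r : ℕ) (P : Set (Euc d)) : Prop :=
  ∃ S : Finset (Euc d), S.card ≤ r ∧ P = convexHull ℝ (S : Set (Euc d))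

theorem EuclideanSpace.norm_le_card_mul_of_abs_le {d : ℕ} (v : Euc d) {M : ℝ}
    (h : ∀ i, |v i| ≤ M) : ‖v‖ ≤ d * M := by
  rcases Nat.eq_zero_or_pos d with rfl | hd
  · simp [Subsingleton.elim v 0]
  have hM : 0 ≤ M := (abs_nonneg _).trans (h ⟨0, hd⟩)
  have hd1 : (1 : ℝ) ≤ d := by exact_mod_cast hd
  rw [EuclideanSpace.norm_eq]
  refine Real.sqrt_le_iff.2 ⟨by positivity, ?_⟩
  calc ∑ i, ‖v i‖ ^ 2 ≤ ∑ _i : Fin d, M ^ 2 :=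
        Finset.sum_le_sum fun i _ => pow_le_pow_left₀ (norm_nonneg _) (h i) 2
    _ = d * M ^ 2 := by simp
    _ ≤ (d * M) ^ 2 := by nlinarith [sq_nonneg M]

/-- The vertices of a cross-polytope of radius `a` centred at `z`. -/
def crossPoint {d : ℕ} (z : Euc d) (a : ℝ) (k : Fin d × Bool) : Euc d :=
  z + EuclideanSpace.single k.1 (if k.2 then a else -a)

/-- A closed convex set passing near every vertex of a cross-polytope contains a ball. -/
theorem closedBall_subset_of_near_crossPoint {d : ℕ} (hd : 1 ≤ d) {Q : Set (Euc d)}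
    (hconv : Convex ℝ Q) (hclosed : IsClosed Q) {z : Euc d} {a δ ρ : ℝ} (ha : 0 ≤ a)
    (h : d * (δ + ρ) ≤ a) (hQ : ∀ k, (Q ∩ closedBall (crossPoint z a k) δ).Nonempty) :
    closedBall z ρ ⊆ Q := by
  intro y hy
  by_contra hyQ
  obtain ⟨f, u, hfu, huy⟩ := geometric_hahn_banach_closed_point hconv hclosed hyQ
  set v := (InnerProductSpace.toDual ℝ (Euc d)).symm f with hv
  have hf : ∀ x, f x = inner ℝ v x := fun x => by
    rw [hv, InnerProductSpace.toDual_symm_apply]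
  have : Nonempty (Fin d) := ⟨⟨0, hd⟩⟩
  obtain ⟨i, hi⟩ := Finite.exists_max fun i => |v i|
  have hnorm := EuclideanSpace.norm_le_card_mul_of_abs_le v hi
  obtain ⟨b, hb⟩ : ∃ b : Bool, (if b then a else -a) * v i = a * |v i| := by
    rcases le_total 0 (v i) with h0 | h0
    · exact ⟨true, by simp [abs_of_nonneg h0]⟩
    · exact ⟨false, by simp [abs_of_nonpos h0]⟩
  obtain ⟨x, hxQ, hx⟩ := hQ (i, b)
  have h1 : f x = f z + a * |v i| + inner ℝ v (x - crossPoint z a (i, b)) := by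
    rw [inner_sub_right, crossPoint, inner_add_right, hf, hf, EuclideanSpace.inner_single_right]
    simp only [conj_trivial]
    linarith
  have h2 : -(‖v‖ * δ) ≤ inner ℝ v (x - crossPoint z a (i, b)) := by
    have := abs_real_inner_le_norm v (x - crossPoint z a (i, b))
    rw [mem_closedBall, dist_eq_norm] at hx
    have h3 := mul_le_mul_of_nonneg_left hx (norm_nonneg v)
    linarith [neg_abs_le (inner ℝ v (x - crossPoint z a (i, b)))]
  have h3 : f y ≤ f z + ‖v‖ * ρ := by
    have h4 := real_inner_le_norm v (y - z)
    rw [mem_closedBall, dist_eq_norm] at hy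
    have h5 := mul_le_mul_of_nonneg_left hy (norm_nonneg v)
    rw [inner_sub_right, ← hf, ← hf] at h4
    linarith
  have h4 := hfu x hxQ
  have hd' : (0 : ℝ) < d := by exact_mod_cast hd
  have h5 : ‖v‖ * (δ + ρ) ≤ a * |v i| := by
    rcases le_total 0 (δ + ρ) with h0 | h0
    · calc ‖v‖ * (δ + ρ) ≤ d * |v i| * (δ + ρ) := mul_le_mul_of_nonneg_right hnorm h0
        _ = d * (δ + ρ) * |v i| := by ring
        _ ≤ a * |v i| := mul_le_mul_of_nonneg_right h (abs_nonneg _)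
    · exact (mul_nonpos_of_nonneg_of_nonpos (norm_nonneg _) h0).trans
        (mul_nonneg ha (abs_nonneg _))
  linarith

/-- A convex set containing a ball and a point far from its centre has large volume. -/
theorem volume_closedBall_le_of_mem {d : ℕ} {Q : Set (Euc d)} (hconv : Convex ℝ Q)
    {z w : Euc d} {ρ : ℝ} (hρ : 0 < ρ) (hball : closedBall z ρ ⊆ Q) (hw : w ∈ Q) :
    ENNReal.ofReal (1 + ‖w - z‖ / (2 * ρ)) * volume (closedBall (0 : Euc d) (ρ / 2)) ≤
      volume Q := by
  set u : Euc d := ‖w - z‖⁻¹ • (w - z) with hu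
  have hu1 : ‖u‖ ≤ 1 := by
    rw [hu, norm_smul, norm_inv, norm_norm]
    exact inv_mul_le_one
  set f : Module.Dual ℝ (Euc d) := ((2 * ρ)⁻¹ : ℝ) • (innerSL ℝ u : Euc d →ₗ[ℝ] ℝ) with hf
  have hfx : ∀ x, f x = (2 * ρ)⁻¹ * inner ℝ u x := fun x => by simp [hf]
  have hfw : f (w - z) = ‖w - z‖ / (2 * ρ) := by
    rw [hfx, hu, inner_smul_left, real_inner_self_eq_norm_sq]
    simp only [conj_trivial]
    rcases eq_or_ne ‖w - z‖ 0 with h0 | h0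
    · simp [h0]
    · field_simp
  have himage : LinearMap.transvection f (w - z) '' closedBall 0 (ρ / 2) ⊆
      (fun x => (z + (1 / 4 : ℝ) • (w - z)) + x) ⁻¹' Q := by
    rintro _ ⟨x, hx, rfl⟩
    rw [mem_closedBall_zero_iff] at hx
    have hfx' : |f x| ≤ 1 / 4 := by
      have h1 := abs_real_inner_le_norm u x
      have h2 : |inner ℝ u x| ≤ ρ / 2 := by nlinarith [norm_nonneg x, norm_nonneg u]
      rw [hfx, abs_mul, abs_of_pos (by positivity)]
      calc (2 * ρ)⁻¹ * |inner ℝ u x| ≤ (2 * ρ)⁻¹ * (ρ / 2) := by gcongr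
        _ = 1 / 4 := by field_simp; norm_num
    obtain ⟨hl, hr⟩ := abs_le.1 hfx'
    have hs : 0 < 1 - (1 / 4 + f x) := by linarith
    have hmem : z + (1 - (1 / 4 + f x))⁻¹ • x ∈ Q := by
      apply hball
      rw [mem_closedBall, dist_eq_norm, add_sub_cancel_left, norm_smul, norm_inv,
        Real.norm_of_nonneg hs.le, inv_mul_le_iff₀ hs]
      nlinarith
    have hcomb := hconv hw hmem (by linarith : 0 ≤ 1 / 4 + f x) hs.le (by ring)
    rw [mem_preimage, LinearMap.transvection.apply]
    convert hcomb using 1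
    rw [smul_add, smul_smul, mul_inv_cancel₀ hs.ne']
    module
  have hvol := measure_mono (μ := volume) himage
  rw [measure_preimage_add, Measure.addHaar_image_linearMap, LinearMap.transvection.det, hfw,
    abs_of_nonneg (by positivity)] at hvol
  exact hvol

/-- The neighbourhood of a convex body is contained in a dilate about the centre of an inner ball. -/
theorem cthickening_subset_homothety_image {d : ℕ} {Q : Set (Euc d)} (hconv : Convex ℝ Q)
    (hcomp : IsCompact Q) {z : Euc d} {ρ s : ℝ} (hρ : 0 < ρ) (hs : 0 < s)
    (hball : closedBall z ρ ⊆ Q) :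
    cthickening s Q ⊆ AffineMap.homothety z (1 + s / ρ) '' Q := by
  intro x hx
  rw [hcomp.cthickening_eq_biUnion_closedBall hs.le] at hx
  obtain ⟨q, hq, hxq⟩ := mem_iUnion₂.1 hx
  rw [mem_closedBall, dist_eq_norm] at hxq
  have ht : 0 < 1 + s / ρ := by positivity
  have hmem : z + (ρ / s) • (x - q) ∈ Q := by
    apply hball
    rw [mem_closedBall, dist_eq_norm, add_sub_cancel_left, norm_smul,
      Real.norm_of_nonneg (by positivity)]
    calc ρ / s * ‖x - q‖ ≤ ρ / s * s := by gcongr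
      _ = ρ := by field_simp
  refine ⟨(1 + s / ρ)⁻¹ • q + ((1 + s / ρ)⁻¹ * (s / ρ)) • (z + (ρ / s) • (x - q)),
    hconv hq hmem (by positivity) (by positivity) (by field_simp), ?_⟩
  rw [AffineMap.homothety_apply, vsub_eq_sub, vadd_eq_add, smul_sub, smul_add, smul_smul, smul_smul,
    mul_inv_cancel_left₀ ht.ne', mul_inv_cancel₀ ht.ne', smul_add, smul_smul]
  have : s / ρ * (ρ / s) = 1 := by field_simp
  rw [this]
  module

theorem volume_cthickening_diff_le {d : ℕ} {Q : Set (Euc d)} (hconv : Convex ℝ Q)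
    (hcomp : IsCompact Q) {z : Euc d} {ρ s : ℝ} (hρ : 0 < ρ) (hs : 0 < s)
    (hball : closedBall z ρ ⊆ Q) :
    volume (cthickening s Q \ Q) ≤ ENNReal.ofReal ((1 + s / ρ) ^ d - 1) * volume Q := by
  have hfin : volume Q ≠ ∞ := hcomp.measure_lt_top.ne
  rw [measure_sdiff (self_subset_cthickening Q) hcomp.measurableSet.nullMeasurableSet hfin]
  have h1 := measure_mono (μ := volume)
    (cthickening_subset_homothety_image hconv hcomp hρ hs hball)
  rw [Measure.addHaar_image_homothety, finrank_euclideanSpace_fin,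
    abs_of_nonneg (by positivity)] at h1
  rw [ENNReal.ofReal_sub _ zero_le_one, ENNReal.sub_mul fun _ _ => hfin]
  simpa using tsub_le_tsub_right h1 _

theorem convexHull_range_subset_cthickening {d : ℕ} {ι : Type*} {w g : ι → Euc d} {η : ℝ}
    (h : ∀ j, dist (w j) (g j) ≤ η) :
    convexHull ℝ (range w) ⊆ cthickening η (convexHull ℝ (range g)) := by
  refine convexHull_min ?_ ((convex_convexHull ℝ _).cthickening η)
  rintro _ ⟨j, rfl⟩
  exact mem_cthickening_of_dist_le _ _ _ _ (subset_convexHull ℝ _ (mem_range_self j)) (h j)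

theorem IsPolytopeWithAtMost.exists_eq_convexHull_range {d r : ℕ} {Q : Set (Euc d)}
    (hQ : IsPolytopeWithAtMost r Q) (hne : Q.Nonempty) :
    ∃ w : Fin r → Euc d, Q = convexHull ℝ (range w) := by
  obtain ⟨S, hS, rfl⟩ := hQ
  have hSne : S.Nonempty := by simpa using hne
  have : Nonempty S := hSne.to_subtype
  obtain ⟨e⟩ : Nonempty (S ↪ Fin r) := Function.Embedding.nonempty_of_card_le (by simpa using hS)
  refine ⟨fun j => (Function.invFun e j : S), ?_⟩
  congr 1
  rw [show (fun j => ((Function.invFun e j : S) : Euc d)) = Subtype.val ∘ Function.invFun e from rfl,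
    (Function.invFun_surjective e.injective).range_comp]
  simp

/-- Points of the cubic grid with mesh `1 / M` and half-width `a / M`. -/
def gridPoint {d : ℕ} (M a : ℕ) (k : Fin d → Fin (2 * a + 1)) : Euc d :=
  WithLp.toLp 2 fun i => ((k i : ℝ) - a) / M

theorem exists_dist_gridPoint_le {d : ℕ} {M a : ℕ} (hM : 0 < M) {x : Euc d}
    (hx : ‖x‖ * M ≤ a) : ∃ k, dist x (gridPoint M a k) ≤ d * (1 / M) := by
  have hM' : (0 : ℝ) < M := by exact_mod_cast hM
  have hcoord : ∀ i, |x i * M| ≤ a := fun i => by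
    rw [abs_mul, abs_of_pos hM']
    exact (mul_le_mul_of_nonneg_right (PiLp.norm_apply_le x i) hM'.le).trans hx
  have hk : ∀ i, ⌊x i * M + a⌋₊ < 2 * a + 1 := fun i => by
    rw [Nat.lt_succ_iff]
    refine Nat.floor_le_of_le ?_
    push_cast
    linarith [(abs_le.1 (hcoord i)).2]
  refine ⟨fun i => ⟨_, hk i⟩, ?_⟩
  rw [dist_eq_norm]
  refine EuclideanSpace.norm_le_card_mul_of_abs_le _ fun i => ?_
  have h0 : 0 ≤ x i * M + a := by linarith [(abs_le.1 (hcoord i)).1]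
  have h1 := Nat.floor_le h0
  have h2 := Nat.lt_floor_add_one (x i * M + a)
  have h3 : (x - gridPoint M a fun i => ⟨_, hk i⟩) i = (x i * M + a - ⌊x i * M + a⌋₊) / M := by
    simp only [gridPoint, PiLp.sub_apply]
    field_simp
    ring
  rw [h3, abs_of_nonneg (div_nonneg (by linarith) hM'.le)]
  gcongr
  linarith

theorem mem_of_coord_nonneg_of_sum_le_one {d : ℕ} {P : Set (Euc d)} (hP : Convex ℝ P)
    (h0 : (0 : Euc d) ∈ P) (he : ∀ i, EuclideanSpace.single i (1 : ℝ) ∈ P) {x : Euc d}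
    (hx : ∀ i, 0 ≤ x i) (hsum : ∑ i, x i ≤ 1) : x ∈ P := by
  have h := hP.sum_mem (t := Finset.univ) (w := fun o : Option (Fin d) => o.elim (1 - ∑ i, x i) x)
    (z := fun o => o.elim 0 fun i => EuclideanSpace.single i (1 : ℝ))
    (by rintro (_ | i) - <;> simp [hx, hsum]) (by simp [Fintype.sum_option])
    (by rintro (_ | i) - <;> simp [h0, he])
  have hx' : x = ∑ i, x i • EuclideanSpace.single i (1 : ℝ) := by
    ext j
    simp [Finset.sum_apply, Pi.single_apply]
  rw [Fintype.sum_option] at h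
  simp only [Option.elim] at h
  rwa [smul_zero, zero_add, ← hx'] at h

/-- `P` has large closed pieces `A k` and a finite family of closed sets `K j` such that every
polytope with at most `r` vertices, of volume at most that of `P` and meeting all the pieces, is
contained in some `K j` that exceeds it by little volume. -/
def AdmitsNet {d : ℕ} (r : ℕ) (κ ι : Type) (c δ : ℝ) (P : Set (Euc d)) : Prop :=
  ∃ (A : κ → Set (Euc d)) (K : ι → Set (Euc d)),
    (∀ k, IsClosed (A k) ∧ A k ⊆ P ∧ ENNReal.ofReal c * volume P ≤ volume (A k)) ∧
    (∀ j, IsClosed (K j)) ∧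
    ∀ Q, IsPolytopeWithAtMost r Q → volume Q ≤ volume P → (∀ k, (Q ∩ A k).Nonempty) →
      ∃ j, Q ⊆ K j ∧ volume (K j \ Q) ≤ ENNReal.ofReal δ * volume P

theorem IsPolytopeWithAtMost.convex {d r : ℕ} {Q : Set (Euc d)}
    (hQ : IsPolytopeWithAtMost r Q) : Convex ℝ Q := by
  obtain ⟨S, -, rfl⟩ := hQ
  exact convex_convexHull ℝ _

theorem IsPolytopeWithAtMost.isCompact {d r : ℕ} {Q : Set (Euc d)}
    (hQ : IsPolytopeWithAtMost r Q) : IsCompact Q := by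
  obtain ⟨S, -, rfl⟩ := hQ
  exact S.finite_toSet.isCompact_convexHull ℝ

theorem one_add_mul_pow_sub_one_le (d : ℕ) {x t : ℝ} (hx : 0 ≤ x) (ht : 0 ≤ t) (ht1 : t ≤ 1) :
    (1 + t * x) ^ d - 1 ≤ t * ((1 + x) ^ d - 1) := by
  have h := (convexOn_pow d).2 (mem_Ici.2 zero_le_one) (mem_Ici.2 (by linarith : 0 ≤ 1 + x))
    (sub_nonneg.2 ht1) ht (by ring)
  simp only [smul_eq_mul, one_pow, mul_one] at h
  rw [show (1 - t) + t * (1 + x) = 1 + t * x by ring] at h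
  linarith

theorem closedBall_crossPoint_subset {d : ℕ} (hd : 1 ≤ d) {P : Set (Euc d)} (hP : Convex ℝ P)
    (h0 : (0 : Euc d) ∈ P) (he : ∀ i, EuclideanSpace.single i (1 : ℝ) ∈ P) {a δ : ℝ}
    (ha : 0 ≤ a) (h : a + δ ≤ 1 / (2 * d)) (k : Fin d × Bool) :
    closedBall (crossPoint (WithLp.toLp 2 fun _ => 1 / (2 * d : ℝ)) a k) δ ⊆ P := by
  intro x hx
  have hd' : (0 : ℝ) < d := by exact_mod_cast hd
  rw [mem_closedBall, dist_eq_norm] at hx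
  have hcoord : ∀ i, |x i - 1 / (2 * d)| ≤ 1 / (2 * d) := fun i => by
    set s : ℝ := EuclideanSpace.single k.1 (if k.2 then a else -a) i with hs
    have h1 := (PiLp.norm_apply_le (x - crossPoint _ a k) i).trans hx
    have h2 : |s| ≤ a := by
      rw [hs, PiLp.single_apply]
      split_ifs <;> simp [abs_of_nonneg ha, ha]
    rw [PiLp.sub_apply, crossPoint, PiLp.add_apply, ← hs, Real.norm_eq_abs] at h1
    have h3 := abs_add_le (x i - (1 / (2 * d) + s)) s
    rw [show x i - (1 / (2 * d) + s) + s = x i - 1 / (2 * d) by ring] at h3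
    linarith
  refine mem_of_coord_nonneg_of_sum_le_one hP h0 he
    (fun i => by linarith [(abs_le.1 (hcoord i)).1]) ?_
  calc ∑ i, x i ≤ ∑ _i : Fin d, 1 / (d : ℝ) := Finset.sum_le_sum fun i _ => by
        have : 1 / (d : ℝ) = 1 / (2 * d) + 1 / (2 * d) := by field_simp; norm_num
        linarith [(abs_le.1 (hcoord i)).2]
    _ = 1 := by simp [hd'.ne']

theorem exists_admitsNet_of_normalized (d : ℕ) (hd : 1 ≤ d) :
    ∃ c : ℝ, 0 < c ∧ ∃ (a : ℕ) (D : ℝ), 0 ≤ D ∧ ∀ P : Set (Euc d), Convex ℝ P →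
      (0 : Euc d) ∈ P → (∀ i, EuclideanSpace.single i (1 : ℝ) ∈ P) → P ⊆ closedBall 0 d →
      ∀ n : ℕ, 1 ≤ n → ∀ r : ℕ,
        AdmitsNet r (Fin d × Bool) (Fin r → Fin d → Fin (2 * (a * n) + 1)) c (D / n) P := by
  have hd' : (0 : ℝ) < d := by exact_mod_cast hd
  have hd1 : (1 : ℝ) ≤ d := by exact_mod_cast hd
  set z : Euc d := WithLp.toLp 2 fun _ => 1 / (2 * d : ℝ) with hz
  set ρ : ℝ := 1 / (8 * d ^ 2) with hρ
  set b : ℝ := 1 / (4 * d) with hb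
  have hρ0 : 0 < ρ := by positivity
  have hb0 : 0 < b := by positivity
  have hρb : d * (ρ + ρ) ≤ b := le_of_eq (by rw [hρ, hb]; field_simp; norm_num)
  have hbρ : b + ρ ≤ 1 / (2 * d) := by
    have h1 : ρ ≤ b := by nlinarith
    have h2 : b + b = 1 / (2 * d) := by rw [hb]; field_simp; norm_num
    linarith
  set R : ℝ := 2 * ρ * (2 * d / ρ) ^ d + ‖z‖ with hR
  have hR0 : 0 ≤ R := by positivity
  refine ⟨(ρ / d) ^ d, by positivity, ⌈R * d⌉₊, (1 + 2 / ρ) ^ d - 1, ?_, ?_⟩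
  · have : (1 : ℝ) ≤ (1 + 2 / ρ) ^ d := one_le_pow₀ (by linarith [show 0 < 2 / ρ by positivity])
    linarith
  intro P hP h0 he hPd n hn r
  have hn' : (0 : ℝ) < n := by exact_mod_cast hn
  have hPvol : ∀ s : ℝ, 0 < s →
      volume P ≤ ENNReal.ofReal ((d / s) ^ d) * volume (closedBall (0 : Euc d) s) := fun s hs => by
    refine (measure_mono hPd).trans_eq ?_
    have := Measure.addHaar_closedBall_mul (volume : Measure (Euc d)) 0
      (by positivity : 0 ≤ d / s) hs.le
    rwa [div_mul_cancel₀ _ hs.ne', finrank_euclideanSpace_fin] at this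
  refine ⟨fun k => closedBall (crossPoint z b k) ρ, fun j => cthickening (1 / n)
    (convexHull ℝ (range fun i => gridPoint (d * n) (⌈R * d⌉₊ * n) (j i))), ?_,
    fun j => isClosed_cthickening, ?_⟩
  · refine fun k => ⟨isClosed_closedBall, closedBall_crossPoint_subset hd hP h0 he hb0.le hbρ k, ?_⟩
    calc ENNReal.ofReal ((ρ / d) ^ d) * volume P
        ≤ ENNReal.ofReal ((ρ / d) ^ d) *
          (ENNReal.ofReal ((d / ρ) ^ d) * volume (closedBall (0 : Euc d) ρ)) := by
          gcongr
          exact hPvol ρ hρ0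
      _ = volume (closedBall (crossPoint z b k) ρ) := by
          rw [← mul_assoc, ← ENNReal.ofReal_mul (by positivity), ← mul_pow,
            Measure.addHaar_closedBall_center _ (crossPoint z b k)]
          rw [show ρ / d * (d / ρ) = 1 by field_simp]
          simp
  intro Q hQ hQvol hQA
  have hQne : Q.Nonempty := (hQA (⟨0, hd⟩, true)).mono inter_subset_left
  have hball : closedBall z ρ ⊆ Q :=
    closedBall_subset_of_near_crossPoint hd hQ.convex hQ.isCompact.isClosed hb0.le hρb hQA
  have hnorm : ∀ w ∈ Q, ‖w‖ ≤ R := fun w hw => by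
    have h1 := (volume_closedBall_le_of_mem hQ.convex hρ0 hball hw).trans
      (hQvol.trans (hPvol (ρ / 2) (by positivity)))
    rw [ENNReal.mul_le_mul_iff_left (measure_closedBall_pos _ _ (by positivity)).ne'
      measure_closedBall_lt_top.ne, ENNReal.ofReal_le_ofReal_iff (by positivity)] at h1
    have h2 : ‖w - z‖ / (2 * ρ) ≤ (2 * d / ρ) ^ d := by
      rw [show 2 * d / ρ = d / (ρ / 2) by field_simp]
      linarith
    rw [div_le_iff₀ (by positivity)] at h2
    have h3 := norm_le_norm_add_norm_sub' w z
    rw [hR]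
    linarith
  obtain ⟨w, hw⟩ := hQ.exists_eq_convexHull_range hQne
  have hgrid : ∀ i, ∃ k, dist (w i) (gridPoint (d * n) (⌈R * d⌉₊ * n) k) ≤ 1 / n := fun i => by
    have hwQ : w i ∈ Q := by
      rw [hw]
      exact subset_convexHull ℝ _ (mem_range_self i)
    obtain ⟨k, hk⟩ := exists_dist_gridPoint_le (M := d * n) (a := ⌈R * d⌉₊ * n) (x := w i)
      (Nat.mul_pos hd hn) (by
        push_cast
        rw [← mul_assoc]
        gcongr
        exact (mul_le_mul_of_nonneg_right (hnorm _ hwQ) hd'.le).trans (Nat.le_ceil _))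
    refine ⟨k, hk.trans_eq ?_⟩
    push_cast
    field_simp
  choose j hj using hgrid
  refine ⟨j, hw ▸ convexHull_range_subset_cthickening hj, ?_⟩
  have hsub : cthickening (1 / n : ℝ)
      (convexHull ℝ (range fun i => gridPoint (d * n) (⌈R * d⌉₊ * n) (j i))) ⊆
      cthickening (1 / n + 1 / n) Q := by
    refine (cthickening_subset_of_subset _ ?_).trans
      (cthickening_cthickening_subset (by positivity) (by positivity) Q)
    rw [hw]
    exact convexHull_range_subset_cthickening fun i => by
      rw [dist_comm]
      exact hj i
  calc _ ≤ volume (cthickening (1 / n + 1 / n : ℝ) Q \ Q) :=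
        measure_mono (sdiff_subset_sdiff_left hsub)
    _ ≤ ENNReal.ofReal ((1 + (1 / n + 1 / n) / ρ) ^ d - 1) * volume Q :=
        volume_cthickening_diff_le hQ.convex hQ.isCompact hρ0 (by positivity) hball
    _ ≤ _ := by
        gcongr
        have hn1 : (1 : ℝ) / n ≤ 1 := by
          rw [div_le_one hn']
          exact_mod_cast hn
        have := one_add_mul_pow_sub_one_le d (x := 2 / ρ) (by positivity)
          (by positivity : (0 : ℝ) ≤ 1 / n) hn1
        rw [show (1 / n + 1 / n) / ρ = 1 / n * (2 / ρ) by ring]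
        exact this.trans_eq (by ring)

theorem AdmitsNet.image {d r : ℕ} {κ ι : Type} {c δ : ℝ} {P : Set (Euc d)}
    (h : AdmitsNet r κ ι c δ P) (L : Euc d ≃ₗ[ℝ] Euc d) (v : Euc d) :
    AdmitsNet r κ ι c δ ((fun x => L x + v) '' P) := by
  obtain ⟨A, K, hA, hK, hQ⟩ := h
  set T : Euc d ≃ₜ Euc d := L.toContinuousLinearEquiv.toHomeomorph.trans (Homeomorph.addRight v)
    with hT
  have hTx : ∀ x, T x = L x + v := fun x => rfl
  set D : ℝ≥0∞ := ENNReal.ofReal |LinearMap.det (L : Euc d →ₗ[ℝ] Euc d)| with hD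
  have hD0 : D ≠ 0 := by
    simpa [hD] using L.isUnit_det'.ne_zero
  have hDtop : D ≠ ∞ := ENNReal.ofReal_ne_top
  have hvol : ∀ s, volume (T '' s) = D * volume s := fun s => by
    have h1 : T '' s = (fun x => x + v) '' ((L : Euc d →ₗ[ℝ] Euc d) '' s) := by
      rw [image_image]
      rfl
    rw [h1, image_add_right, measure_preimage_add_right, Measure.addHaar_image_linearMap]
  change AdmitsNet r κ ι c δ (T '' P)
  refine ⟨fun k => T '' A k, fun j => T '' K j, fun k => ⟨?_, image_mono (hA k).2.1, ?_⟩,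
    fun j => T.isClosed_image.2 (hK j), fun Q hQr hQvol hQA => ?_⟩
  · exact T.isClosed_image.2 (hA k).1
  · rw [hvol, hvol, mul_left_comm]
    gcongr
    exact (hA k).2.2
  have hQT : T '' (T ⁻¹' Q) = Q := image_preimage_eq Q T.surjective
  have hpoly : IsPolytopeWithAtMost r (T ⁻¹' Q) := by
    classical
    obtain ⟨S, hS, rfl⟩ := hQr
    refine ⟨S.image T.symm, Finset.card_image_le.trans hS, ?_⟩
    set F : Euc d →ᵃ[ℝ] Euc d := (L.symm : Euc d →ₗ[ℝ] Euc d).toAffineMap.comp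
      (AffineEquiv.constVAdd ℝ (Euc d) (-v) : Euc d →ᵃ[ℝ] Euc d) with hF
    have hFT : ⇑F = T.symm := by
      ext1 x
      refine T.injective ?_
      rw [T.apply_symm_apply, hTx, hF]
      simp
    rw [← T.image_symm, Finset.coe_image, ← hFT, AffineMap.image_convexHull]
  obtain ⟨j, hj, hjvol⟩ := hQ (T ⁻¹' Q) hpoly (by
      rw [← hQT, hvol, hvol] at hQvol
      exact (ENNReal.mul_le_mul_iff_right hD0 hDtop).1 hQvol) fun k => by
    obtain ⟨_, hx, y, hy, rfl⟩ := hQA k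
    exact ⟨y, hx, hy⟩
  refine ⟨j, by rw [← hQT]; exact image_mono hj, ?_⟩
  rw [← hQT, ← image_sdiff T.injective, hvol, hvol, mul_left_comm]
  gcongr

theorem exists_basis_abs_repr_le_one {d : ℕ} {S : Set (Euc d)} (hS : S.Finite)
    (hspan : Submodule.span ℝ S = ⊤) :
    ∃ b : Module.Basis (Fin d) ℝ (Euc d), (∀ i, b i ∈ S) ∧ ∀ s ∈ S, ∀ i, |b.repr s i| ≤ 1 := by
  set e := (EuclideanSpace.basisFun (Fin d) ℝ).toBasis with he
  have hfin : (Set.univ.pi fun _ : Fin d => S).Finite := Set.Finite.pi fun _ => hS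
  have hfr : Module.finrank ℝ (Submodule.span ℝ S) = d := by
    rw [hspan, finrank_top, finrank_euclideanSpace_fin]
  obtain ⟨f, hfS, -, hf⟩ := Submodule.exists_fun_fin_finrank_span_eq ℝ S
  obtain ⟨g, hgS, hg⟩ : ∃ g : Fin d → Euc d, (∀ i, g i ∈ S) ∧ LinearIndependent ℝ g :=
    ⟨f ∘ finCongr hfr.symm, fun i => hfS _, hf.comp _ (finCongr hfr.symm).injective⟩
  have hdet : ∀ g : Fin d → Euc d, LinearIndependent ℝ g → e.det g ≠ 0 := fun g hg => by
    have hb := (e.is_basis_iff_det (v := g)).1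
      ⟨hg, hg.span_eq_top_of_card_eq_finrank' (by simp)⟩
    exact hb.ne_zero
  obtain ⟨m, hmS, hmax⟩ := hfin.exists_maximalFor (fun g => |e.det g|) _ ⟨g, fun i _ => hgS i⟩
  have hle : ∀ g : Fin d → Euc d, (∀ i, g i ∈ S) → |e.det g| ≤ |e.det m| := fun g hg => by
    rcases le_total |e.det g| |e.det m| with h | h
    · exact h
    · exact hmax (fun i _ => hg i) h
  have hm0 : e.det m ≠ 0 := abs_pos.1 ((abs_pos.2 (hdet g hg)).trans_le (hle g hgS))
  obtain ⟨hli, hsp⟩ := (e.is_basis_iff_det (v := m)).2 hm0.isUnit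
  set b := Module.Basis.mk hli hsp.ge with hb
  have hbm : ⇑b = m := Module.Basis.coe_mk _ _
  refine ⟨b, fun i => by rw [hbm]; exact hmS i (mem_univ i), fun s hs i => ?_⟩
  have h1 : e.det (Function.update m i s) = b.repr s i * e.det m := by
    have h2 := e.det_smul_mk_coord_eq_det_update hli hsp.ge i
    have h3 := LinearMap.congr_fun h2 s
    simp only [LinearMap.smul_apply, smul_eq_mul, MultilinearMap.toLinearMap_apply] at h3
    rw [mul_comm]
    exact h3.symm
  have h2 := hle (Function.update m i s) fun k => by
    rcases eq_or_ne k i with rfl | hk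
    · simpa using hs
    · simpa [hk] using hmS k (mem_univ k)
  rw [h1, abs_mul] at h2
  exact (mul_le_iff_le_one_left (abs_pos.2 hm0)).1 h2

theorem exists_admitsNet (d : ℕ) (hd : 1 ≤ d) :
    ∃ c : ℝ, 0 < c ∧ ∃ (a : ℕ) (D : ℝ), 0 ≤ D ∧ ∀ (n r s : ℕ) (P : Set (Euc d)), 1 ≤ n →
      IsPolytopeWithAtMost s P → (interior P).Nonempty →
        AdmitsNet r (Fin d × Bool) (Fin r → Fin d → Fin (2 * (a * n) + 1)) c (D / n) P := by
  obtain ⟨c, hc, a, D, hD, h⟩ := exists_admitsNet_of_normalized d hd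
  refine ⟨c, hc, a, D, hD, fun n r s P hn hP hint => ?_⟩
  obtain ⟨S, -, rfl⟩ := hP
  obtain ⟨v, hv⟩ : (S : Set (Euc d)).Nonempty :=
    (convexHull_nonempty_iff (𝕜 := ℝ)).1 (hint.mono interior_subset)
  have htop := interior_convexHull_nonempty_iff_affineSpan_eq_top.1 hint
  have hspan : Submodule.span ℝ ((· -ᵥ v) '' (S : Set (Euc d))) = ⊤ := by
    rw [← vectorSpan_eq_span_vsub_set_right ℝ hv]
    exact AffineSubspace.vectorSpan_eq_top_of_affineSpan_eq_top ℝ _ _ htop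
  obtain ⟨b, hbS, hb⟩ := exists_basis_abs_repr_le_one (S.finite_toSet.image _) hspan
  set L : Euc d ≃ₗ[ℝ] Euc d := (b.equivFun.trans (WithLp.linearEquiv 2 ℝ (Fin d → ℝ)).symm).symm
    with hL
  have hLsymm : ∀ x i, L.symm x i = b.repr x i := fun x i => rfl
  have hLe : ∀ i, L (EuclideanSpace.single i 1) = b i := fun i => by
    rw [← L.eq_symm_apply]
    ext j
    rw [hLsymm]
    simp [Finsupp.single_apply, eq_comm]
  set T : Euc d →ᵃ[ℝ] Euc d := AffineMap.mk (fun x => L x + v) (L : Euc d →ₗ[ℝ] Euc d)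
    (fun p u => by simp [add_assoc]) with hT
  have hTx : ∀ x, T x = L x + v := fun x => rfl
  have hsurj : ∀ x, T (L.symm (x - v)) = x := fun x => by simp [hTx]
  set P' : Set (Euc d) := convexHull ℝ ((fun x => L.symm (x - v)) '' S) with hP'
  have himage : (fun x => L x + v) '' P' = convexHull ℝ (S : Set (Euc d)) := by
    change T '' P' = _
    rw [hP', AffineMap.image_convexHull, image_image]
    simp only [hsurj, image_id']
  rw [← himage]
  refine (h P' (convex_convexHull ℝ _) ?_ ?_ ?_ n hn r).image L v
  · exact subset_convexHull ℝ _ ⟨v, hv, by simp⟩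
  · intro i
    obtain ⟨x, hx, hxi⟩ := hbS i
    refine subset_convexHull ℝ _ ⟨x, hx, ?_⟩
    rw [LinearEquiv.symm_apply_eq, hLe]
    exact hxi
  · refine convexHull_min ?_ (convex_closedBall _ _)
    rintro _ ⟨x, hx, rfl⟩
    rw [mem_closedBall_zero_iff]
    refine (EuclideanSpace.norm_le_card_mul_of_abs_le (M := 1) _ fun i => ?_).trans_eq (mul_one _)
    rw [hLsymm]
    exact hb _ ⟨x, hx, rfl⟩ i

theorem unifMeasure_le_exp_neg {d : ℕ} {P S : Set (Euc d)} (hS : MeasurableSet S)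
    (hP0 : volume P ≠ 0) (hPtop : volume P ≠ ∞) {t : ℝ} (ht : 0 ≤ t)
    (h : ENNReal.ofReal t * volume P ≤ volume (P \ S)) :
    unifMeasure P S ≤ ENNReal.ofReal (Real.exp (-t)) := by
  have h1 : volume (S ∩ P) ≤ ENNReal.ofReal (1 - t) * volume P := by
    rw [ENNReal.ofReal_sub _ ht, ENNReal.sub_mul fun _ _ => hPtop, ENNReal.ofReal_one, one_mul]
    refine ENNReal.le_sub_of_add_le_right (ENNReal.mul_ne_top ENNReal.ofReal_ne_top hPtop) ?_
    rw [← measure_inter_add_sdiff P hS, inter_comm S P]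
    exact add_le_add_right ((measure_inter_add_sdiff P hS).symm ▸ h) _
  rw [unifMeasure, Measure.smul_apply, Measure.restrict_apply hS, smul_eq_mul]
  calc (volume P)⁻¹ * volume (S ∩ P)
      ≤ (volume P)⁻¹ * (ENNReal.ofReal (1 - t) * volume P) := by gcongr
    _ = ENNReal.ofReal (1 - t) := by
        rw [mul_left_comm, ENNReal.inv_mul_cancel hP0 hPtop, mul_one]
    _ ≤ ENNReal.ofReal (Real.exp (-t)) :=
        ENNReal.ofReal_le_ofReal (by linarith [Real.add_one_le_exp (-t)])

theorem sampleMeasure_forall_mem_le {d : ℕ} {P S : Set (Euc d)} (n : ℕ) (hS : MeasurableSet S)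
    (hP0 : volume P ≠ 0) (hPtop : volume P ≠ ∞) {t : ℝ} (ht : 0 ≤ t)
    (h : ENNReal.ofReal t * volume P ≤ volume (P \ S)) :
    sampleMeasure P n {ω | ∀ i, ω i ∈ S} ≤ ENNReal.ofReal (Real.exp (-(t * n))) := by
  have hset : {ω : Fin n → Euc d | ∀ i, ω i ∈ S} = Set.univ.pi fun _ => S := by
    ext ω
    simp
  rw [hset, sampleMeasure, Measure.pi_pi, Finset.prod_const, Finset.card_univ, Fintype.card_fin]
  calc unifMeasure P S ^ n ≤ ENNReal.ofReal (Real.exp (-t)) ^ n :=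
        pow_le_pow_left' (unifMeasure_le_exp_neg hS hP0 hPtop ht h) n
    _ = _ := by
        rw [← ENNReal.ofReal_pow (Real.exp_nonneg _), ← Real.exp_nat_mul]
        ring_nf

theorem ae_sampleMeasure_forall_mem {d : ℕ} {P : Set (Euc d)} (n : ℕ) (hP : MeasurableSet P) :
    ∀ᵐ ω ∂sampleMeasure P n, ∀ i, ω i ∈ P := by
  refine Filter.eventually_all.2 fun i => ?_
  have h : ∀ᵐ x ∂unifMeasure P, x ∈ P := Measure.ae_smul_measure (ae_restrict_mem hP) _
  exact (Measure.tendsto_eval_ae_ae (μ := fun _ : Fin n => unifMeasure P) (i := i)).eventually h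

theorem measure_symmDiff_le_two_mul {d : ℕ} {P Q : Set (Euc d)} (hP : MeasurableSet P)
    (hQ : MeasurableSet Q) (hPtop : volume P ≠ ∞) (h : volume Q ≤ volume P) :
    volume (P ∆ Q) ≤ 2 * volume (P \ Q) := by
  have h1 : volume (Q \ P) ≤ volume (P \ Q) := by
    rw [← measure_inter_add_sdiff P hQ, ← measure_inter_add_sdiff Q hP, inter_comm Q P] at h
    exact (ENNReal.add_le_add_iff_left
      (measure_ne_top_of_subset inter_subset_left hPtop)).1 h
  rw [two_mul]
  exact (measure_union_le _ _).trans (by gcongr)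

theorem AdmitsNet.lintegral_symmDiff_le {d r : ℕ} {κ ι : Type} [Fintype κ] [Fintype ι] {c δ t : ℝ}
    {P : Set (Euc d)} (h : AdmitsNet r κ ι c δ P) (hc : 0 ≤ c) (hδ : 0 ≤ δ) (ht : 0 ≤ t)
    (hP : IsPolytopeWithAtMost r P) (hP0 : volume P ≠ 0) (n : ℕ)
    {Phat : (Fin n → Euc d) → Set (Euc d)}
    (hPhat : ∀ ω, IsPolytopeWithAtMost r (Phat ω) ∧ Set.range ω ⊆ Phat ω ∧
      ∀ Q : Set (Euc d), IsPolytopeWithAtMost r Q → Set.range ω ⊆ Q →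
        volume (Phat ω) ≤ volume Q) :
    ∫⁻ ω, volume (P ∆ Phat ω) / volume P ∂(sampleMeasure P n) ≤
      ENNReal.ofReal (2 * (t + δ)) * sampleMeasure P n univ +
        2 * (Fintype.card κ * ENNReal.ofReal (Real.exp (-(c * n))) +
          Fintype.card ι * ENNReal.ofReal (Real.exp (-(t * n)))) := by
  obtain ⟨A, K, hA, hK, hnet⟩ := h
  have hPm : MeasurableSet P := hP.isCompact.measurableSet
  have hPtop : volume P ≠ ∞ := hP.isCompact.measure_lt_top.ne
  set μ := sampleMeasure P n with hμ
  set B₁ : κ → Set (Fin n → Euc d) := fun k => {ω | ∀ i, ω i ∈ (A k)ᶜ} with hB₁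
  set B₂ : ι → Set (Fin n → Euc d) := fun j =>
    {ω | (∀ i, ω i ∈ K j) ∧ ENNReal.ofReal t * volume P ≤ volume (P \ K j)} with hB₂
  set B : Set (Fin n → Euc d) := (⋃ k, B₁ k) ∪ ⋃ j, B₂ j with hB
  have hμB₁ : ∀ k, μ (B₁ k) ≤ ENNReal.ofReal (Real.exp (-(c * n))) := fun k => by
    refine sampleMeasure_forall_mem_le n (hA k).1.measurableSet.compl hP0 hPtop hc ?_
    rw [sdiff_compl, inter_eq_right.2 (hA k).2.1]
    exact (hA k).2.2
  have hμB₂ : ∀ j, μ (B₂ j) ≤ ENNReal.ofReal (Real.exp (-(t * n))) := fun j => by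
    by_cases hj : ENNReal.ofReal t * volume P ≤ volume (P \ K j)
    · exact (measure_mono fun ω hω => hω.1).trans
        (sampleMeasure_forall_mem_le n (hK j).measurableSet hP0 hPtop ht hj)
    · simp [hB₂, hj]
  have hμB : μ B ≤ Fintype.card κ * ENNReal.ofReal (Real.exp (-(c * n))) +
      Fintype.card ι * ENNReal.ofReal (Real.exp (-(t * n))) := by
    refine (measure_union_le _ _).trans (add_le_add ?_ ?_)
    · refine (measure_iUnion_fintype_le _ _).trans ((Finset.sum_le_sum fun k _ => hμB₁ k).trans ?_)
      simp
    · refine (measure_iUnion_fintype_le _ _).trans ((Finset.sum_le_sum fun j _ => hμB₂ j).trans ?_)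
      simp
  calc ∫⁻ ω, volume (P ∆ Phat ω) / volume P ∂μ
      ≤ ∫⁻ ω, ENNReal.ofReal (2 * (t + δ)) + B.indicator (fun _ => 2) ω ∂μ := by
        refine lintegral_mono_ae ?_
        filter_upwards [ae_sampleMeasure_forall_mem n hPm] with ω hω
        obtain ⟨hpoly, hmem, hmin⟩ := hPhat ω
        have hvol : volume (Phat ω) ≤ volume P := hmin P hP (range_subset_iff.2 hω)
        have hsymm := measure_symmDiff_le_two_mul hPm hpoly.isCompact.measurableSet hPtop hvol
        rw [ENNReal.div_le_iff hP0 hPtop]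
        by_cases hωB : ω ∈ B
        · rw [indicator_of_mem hωB]
          calc _ ≤ 2 * volume (P \ Phat ω) := hsymm
            _ ≤ 2 * volume P := by gcongr; exact sdiff_subset
            _ ≤ _ := by gcongr; exact le_add_self
        · rw [indicator_of_notMem hωB, add_zero]
          rw [hB, mem_union, not_or, mem_iUnion, mem_iUnion, not_exists, not_exists] at hωB
          obtain ⟨j, hj, hjvol⟩ := hnet (Phat ω) hpoly hvol fun k => by
            have hk := hωB.1 k
            simp only [hB₁, mem_ofPred_eq, mem_compl_iff, not_forall, not_not] at hk
            obtain ⟨i, hi⟩ := hk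
            exact ⟨ω i, hmem (mem_range_self i), hi⟩
          have hlt : volume (P \ K j) ≤ ENNReal.ofReal t * volume P := by
            by_contra hcon
            exact hωB.2 j ⟨fun i => hj (hmem (mem_range_self i)), (not_le.1 hcon).le⟩
          calc _ ≤ 2 * volume (P \ Phat ω) := hsymm
            _ ≤ 2 * (volume (P \ K j) + volume (K j \ Phat ω)) := by
                gcongr
                refine (measure_mono ?_).trans (measure_union_le _ _)
                intro x hx
                by_cases hxK : x ∈ K j
                · exact Or.inr ⟨hxK, hx.2⟩
                · exact Or.inl ⟨hx.1, hxK⟩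
            _ ≤ 2 * (ENNReal.ofReal t * volume P + ENNReal.ofReal δ * volume P) := by gcongr
            _ = _ := by
                rw [← add_mul, ← ENNReal.ofReal_add ht hδ, ENNReal.ofReal_mul zero_le_two, mul_assoc]
                simp
    _ = ENNReal.ofReal (2 * (t + δ)) * μ univ + ∫⁻ ω, B.indicator (fun _ => 2) ω ∂μ := by
        rw [lintegral_add_left measurable_const, lintegral_const]
    _ ≤ _ := by
        gcongr
        exact (lintegral_indicator_const_le _ _).trans (by gcongr)

theorem sampleMeasure_univ_le_one {d : ℕ} (P : Set (Euc d)) (n : ℕ) :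
    sampleMeasure P n univ ≤ 1 := by
  rw [sampleMeasure, Measure.pi_univ]
  refine Finset.prod_le_one' fun i _ => ?_
  rw [unifMeasure, Measure.smul_apply, Measure.restrict_apply_univ, smul_eq_mul]
  exact ENNReal.inv_mul_le_one _

/-- The maximum likelihood estimator over polytopes with at most `r` vertices (a minimum-volume
polytope with at most `r` vertices containing the sample) estimates a polytopal support with at
most `r` vertices at the rate `r·ln(n)/n` in the Nikodym metric. -/
theorem mle_polytope_upper_bound (d : ℕ) (hd : 1 ≤ d) :
    ∃ C : ℝ, 0 < C ∧
      ∀ r : ℕ, d + 1 ≤ r →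
        ∀ n : ℕ, 2 ≤ n →
          ∀ P : Set (Euc d), IsPolytopeWithAtMost r P → (interior P).Nonempty →
            ∀ Phat : (Fin n → Euc d) → Set (Euc d),
              Measurable (fun ω => volume (P ∆ Phat ω)) →
              (∀ ω, IsPolytopeWithAtMost r (Phat ω) ∧ Set.range ω ⊆ Phat ω ∧
                ∀ Q : Set (Euc d), IsPolytopeWithAtMost r Q → Set.range ω ⊆ Q →
                  volume (Phat ω) ≤ volume Q) →
              (∫⁻ ω, volume (P ∆ Phat ω) / volume P ∂(sampleMeasure P n)) ≤
                ENNReal.ofReal (C * (r : ℝ) * Real.log n / n) := by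
  obtain ⟨c, hc, a, D, hD, hnet⟩ := exists_admitsNet d hd
  have hl2 : 0 < Real.log 2 := Real.log_pos one_lt_two
  set E : ℝ := Real.log (2 * a + 1) with hE
  have hE0 : 0 ≤ E := Real.log_nonneg (by linarith [(Nat.cast_nonneg a : (0 : ℝ) ≤ a)])
  set F : ℝ := 2 * (D + 1 + 2 * d / c) with hF
  have hF0 : 0 < F := by positivity
  refine ⟨2 * (d * (E / Real.log 2 + 1) + 1) + F / Real.log 2, by positivity, ?_⟩
  intro r hr n hn P hP hint Phat _ hPhat
  have hn0 : (0 : ℝ) < n := by positivity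
  have hn1 : (1 : ℝ) ≤ n := by exact_mod_cast one_le_two.trans hn
  have hr1 : (1 : ℝ) ≤ r := by exact_mod_cast (Nat.le_add_left 1 d).trans hr
  have hln : Real.log 2 ≤ Real.log n := Real.log_le_log two_pos (by exact_mod_cast hn)
  have hln0 : 0 < Real.log n := hl2.trans_le hln
  have hP0 : volume P ≠ 0 :=
    ((isOpen_interior.measure_pos volume hint).trans_le (measure_mono interior_subset)).ne'
  set N : ℝ := (((2 * (a * n) + 1 : ℕ) : ℝ) ^ d) ^ r with hN
  have hbase : (1 : ℝ) ≤ ((2 * (a * n) + 1 : ℕ) : ℝ) := by exact_mod_cast Nat.le_add_left 1 _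
  have hN1 : 1 ≤ N := one_le_pow₀ (one_le_pow₀ hbase)
  have hlogN : Real.log N ≤ r * (d * (E + Real.log n)) := by
    rw [hN, Real.log_pow, Real.log_pow]
    gcongr
    rw [hE, ← Real.log_mul (by positivity) hn0.ne']
    refine Real.log_le_log (by positivity) ?_
    push_cast
    linarith
  set t : ℝ := (Real.log N + Real.log n) / n with ht
  have ht0 : 0 ≤ t := div_nonneg (add_nonneg (Real.log_nonneg hN1) hln0.le) hn0.le
  have hexp : N * Real.exp (-(t * n)) = 1 / n := by
    rw [ht, div_mul_cancel₀ _ hn0.ne', neg_add, Real.exp_add, Real.exp_neg, Real.exp_neg,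
      Real.exp_log (by positivity), Real.exp_log hn0]
    field_simp
  have hexpc : Real.exp (-(c * n)) ≤ 1 / (c * n) := by
    rw [Real.exp_neg, ← one_div]
    exact one_div_le_one_div_of_le (by positivity) (by linarith [Real.add_one_le_exp (c * n)])
  have hmain := (hnet n r r P (one_le_two.trans hn) hP hint).lintegral_symmDiff_le hc.le
    (by positivity) ht0 hP hP0 n hPhat
  refine hmain.trans ?_
  have hcardκ : (Fintype.card (Fin d × Bool) : ℝ≥0∞) = ENNReal.ofReal (2 * d) := by
    rw [Fintype.card_prod, Fintype.card_fin, Fintype.card_bool, ← ENNReal.ofReal_natCast]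
    push_cast
    rw [mul_comm]
  have hcardι : (Fintype.card (Fin r → Fin d → Fin (2 * (a * n) + 1)) : ℝ≥0∞) =
      ENNReal.ofReal N := by
    rw [Fintype.card_fun, Fintype.card_fun, Fintype.card_fin, Fintype.card_fin, Fintype.card_fin,
      ← ENNReal.ofReal_natCast, hN]
    push_cast
    rfl
  rw [hcardκ, hcardι, ← ENNReal.ofReal_mul (by positivity), ← ENNReal.ofReal_mul (by positivity),
    ← ENNReal.ofReal_add (by positivity) (by positivity)]
  have hfinal : 2 * (t + D / n) + 2 * (2 * d * Real.exp (-(c * n)) + N * Real.exp (-(t * n))) ≤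
      (2 * (d * (E / Real.log 2 + 1) + 1) + F / Real.log 2) * r * Real.log n / n := by
    have h1 : 2 * d * Real.exp (-(c * n)) ≤ 2 * d / c / n := by
      calc 2 * d * Real.exp (-(c * n)) ≤ 2 * d * (1 / (c * n)) := by gcongr
        _ = 2 * d / c / n := by field_simp
    have h2 : E ≤ E / Real.log 2 * Real.log n := by
      rw [div_mul_eq_mul_div, le_div_iff₀ hl2]
      gcongr
    have h3 : F ≤ F / Real.log 2 * (r * Real.log n) := by
      rw [div_mul_eq_mul_div, le_div_iff₀ hl2]
      gcongr
      nlinarith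
    have h4 : t ≤ (d * (E / Real.log 2 + 1) + 1) * (r * Real.log n) / n := by
      rw [ht]
      gcongr
      calc Real.log N + Real.log n
          ≤ r * (d * (E / Real.log 2 * Real.log n + Real.log n)) + r * Real.log n := by
            refine add_le_add (hlogN.trans ?_) (by nlinarith)
            gcongr
        _ = _ := by ring
    rw [hexp]
    calc _ ≤ 2 * ((d * (E / Real.log 2 + 1) + 1) * (r * Real.log n) / n + D / n) +
          2 * (2 * d / c / n + 1 / n) := by gcongr
      _ = (2 * (d * (E / Real.log 2 + 1) + 1) * (r * Real.log n) + F) / n := by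
          rw [hF]
          ring
      _ ≤ (2 * (d * (E / Real.log 2 + 1) + 1) * (r * Real.log n) +
          F / Real.log 2 * (r * Real.log n)) / n := by gcongr
      _ = _ := by ring
  calc _ ≤ ENNReal.ofReal (2 * (t + D / n)) * 1 + 2 * ENNReal.ofReal
        (2 * d * Real.exp (-(c * n)) + N * Real.exp (-(t * n))) := by
        gcongr
        exact sampleMeasure_univ_le_one P n
    _ = ENNReal.ofReal (2 * (t + D / n) +
        2 * (2 * d * Real.exp (-(c * n)) + N * Real.exp (-(t * n)))) := by
        rw [mul_one, ENNReal.ofReal_add (p := 2 * (t + D / n)) (by positivity) (by positivity),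
          ENNReal.ofReal_mul (p := 2) (q := _ + N * Real.exp _) zero_le_two]
        simp
    _ ≤ _ := ENNReal.ofReal_le_ofReal hfinal
end
end

section
/- Let d ≥ 1. There exist positive constants a1, a2, a3 (depending only on d) such that the following holds. For every integer n ≥ 2, every x ≥ 0, and every convex body G ⊆ ℝ^d, if X_1, …, X_n are i.i.d. points uniformly distributed in G and K̂_n is their convex hull, then with P_G-probability at least 1 − a2·e^{−a3·x}: |G \ K̂_n| / |G| ≤ a1·n^{-2/(d+1)} + x/n. -/
open MeasureTheory Metric Set
open scoped RealInnerProductSpace ENNReal symmDiff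

noncomputable section

/-- A separated subset of a sphere of radius `ρ` has at most `O((ρ / h) ^ (d - 1))` points. -/
lemma card_mul_pow_le_of_separated_sphere {d : ℕ} (hd : 1 ≤ d) {ρ h : ℝ} (hh : 0 < h)
    (hρ : h ≤ ρ) (F : Finset (Euc d)) (hF : ∀ u ∈ F, ‖u‖ = ρ)
    (hsep : ∀ u ∈ F, ∀ v ∈ F, u ≠ v → h ≤ dist u v) :
    (F.card : ℝ) * h ^ (d - 1) ≤ 2 ^ d * d * (2 * ρ) ^ (d - 1) := by
  have : Nonempty (Fin d) := ⟨⟨0, hd⟩⟩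
  have hball : ∀ (x : Euc d) (r : ℝ), 0 ≤ r →
      volume.real (ball x r) = r ^ d * volume.real (ball (0 : Euc d) 1) := fun x r hr => by
    rw [Measure.real, Measure.addHaar_ball _ _ hr, ENNReal.toReal_mul, Measure.real,
      ENNReal.toReal_ofReal (by positivity), finrank_euclideanSpace_fin]
  have hfin : ∀ (x : Euc d) (r : ℝ), volume (ball x r) ≠ ⊤ := fun _ _ => measure_ball_lt_top.ne
  have hdisj : Set.PairwiseDisjoint (F : Set (Euc d)) fun u => ball u (h / 2) := by
    intro u hu v hv huv
    exact ball_disjoint_ball (by linarith [hsep u hu v hv huv])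
  have hU : volume.real (⋃ u ∈ F, ball u (h / 2)) =
      F.card * ((h / 2) ^ d * volume.real (ball (0 : Euc d) 1)) := by
    rw [measureReal_biUnion_finset hdisj (fun _ _ => measurableSet_ball)
      (fun _ _ => hfin _ _), Finset.sum_congr rfl (fun u _ => hball u _ (by positivity)),
      Finset.sum_const, nsmul_eq_mul]
  have hdisj' : Disjoint (⋃ u ∈ F, ball u (h / 2)) (ball (0 : Euc d) (ρ - h / 2)) := by
    simp only [Set.disjoint_iUnion_left]
    intro u hu
    apply ball_disjoint_ball
    rw [dist_zero_right, hF u hu]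
    linarith
  have hsub : (⋃ u ∈ F, ball u (h / 2)) ∪ ball (0 : Euc d) (ρ - h / 2) ⊆
      ball (0 : Euc d) (ρ + h / 2) := by
    refine Set.union_subset (Set.iUnion₂_subset fun u hu => ?_) (ball_subset_ball (by linarith))
    apply ball_subset_ball'
    rw [dist_zero_right, hF u hu]
    linarith
  have hle := measureReal_mono hsub (hfin _ _)
  rw [measureReal_union hdisj' measurableSet_ball
    (ne_top_of_le_ne_top (hfin _ _) (measure_mono (Set.subset_union_left.trans hsub))) (hfin _ _),
    hU, hball _ (ρ - h / 2) (by linarith), hball _ (ρ + h / 2) (by linarith),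
    ← mul_assoc, ← add_mul] at hle
  have hpos : 0 < volume.real (ball (0 : Euc d) 1) :=
    ENNReal.toReal_pos (measure_ball_pos _ _ one_pos).ne' (hfin _ _)
  replace hle := le_of_mul_le_mul_right hle hpos
  have hdiff : (ρ + h / 2) ^ d - (ρ - h / 2) ^ d ≤ h * d * (2 * ρ) ^ (d - 1) := by
    refine (le_abs_self _).trans ((abs_pow_sub_pow_le ..).trans ?_)
    rw [show ρ + h / 2 - (ρ - h / 2) = h by ring, abs_of_pos hh,
      abs_of_pos (by linarith : 0 < ρ + h / 2), abs_of_pos (by linarith : 0 < ρ - h / 2),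
      max_eq_left (by linarith)]
    have : ρ + h / 2 ≤ 2 * ρ := by linarith
    have : 0 ≤ ρ + h / 2 := by linarith
    gcongr
  have key : (F.card : ℝ) * (h / 2) ^ d ≤ h * d * (2 * ρ) ^ (d - 1) := by linarith
  obtain ⟨e, rfl⟩ : ∃ e, d = e + 1 := ⟨d - 1, by omega⟩
  simp only [Nat.add_sub_cancel] at key ⊢
  refine le_of_mul_le_mul_left ?_ hh
  calc h * (F.card * h ^ e) = 2 ^ (e + 1) * (F.card * (h / 2) ^ (e + 1)) := by
        rw [div_pow, pow_succ h]; field_simp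
    _ ≤ 2 ^ (e + 1) * (h * (e + 1 : ℕ) * (2 * ρ) ^ e) := by gcongr
    _ = _ := by ring

/-- A sphere of radius `ρ` has an `h`-net with `O((ρ / h) ^ (d - 1))` points. -/
lemma exists_sphere_net {d : ℕ} (hd : 1 ≤ d) {ρ h : ℝ} (hh : 0 < h) (hρ : h ≤ ρ) :
    ∃ U : Finset (Euc d), (U.card : ℝ) * h ^ (d - 1) ≤ 2 ^ d * d * (2 * ρ) ^ (d - 1) ∧
      ∀ u : Euc d, ‖u‖ = ρ → ∃ v ∈ U, ‖u - v‖ ≤ h := by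
  classical
  set ε : NNReal := ⟨h, hh.le⟩
  set A : Set (Euc d) := sphere 0 ρ
  have hcard : ∀ F : Finset (Euc d), (F : Set (Euc d)) ⊆ A → IsSeparated ε (F : Set (Euc d)) →
      (F.card : ℝ) * h ^ (d - 1) ≤ 2 ^ d * d * (2 * ρ) ^ (d - 1) := by
    intro F hFA hF
    refine card_mul_pow_le_of_separated_sphere hd hh hρ F
      (fun u hu => by simpa [A] using hFA hu) fun u hu v hv huv => ?_
    have : (ε : ENNReal) < edist u v := hF hu hv huv
    rw [edist_nndist, ENNReal.coe_lt_coe] at this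
    exact (NNReal.coe_lt_coe.2 this).le
  obtain ⟨N, hN⟩ := exists_nat_ge (2 ^ d * d * (2 * ρ) ^ (d - 1) / h ^ (d - 1))
  have hbound : packingNumber ε A ≤ N := by
    refine iSup_le fun C => iSup_le fun hCA => iSup_le fun hC => ?_
    by_contra! hlt
    obtain ⟨D, hDC, hD⟩ := Set.exists_subset_encard_eq (Order.add_one_le_of_lt hlt)
    have hDfin : D.Finite := Set.finite_of_encard_eq_coe (k := N + 1) (by simpa using hD)
    have h1 := hcard hDfin.toFinset (by simpa using hDC.trans hCA)
      (by simpa using hC.subset hDC)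
    have h2 : hDfin.toFinset.card = N + 1 := by
      rw [hDfin.encard_eq_coe_toFinset_card] at hD
      exact_mod_cast hD
    rw [h2, ← le_div_iff₀ (by positivity)] at h1
    push_cast at h1
    linarith
  have htop : packingNumber ε A ≠ ⊤ := ne_top_of_le_ne_top (ENat.natCast_ne_top N) hbound
  have hfin : (maximalSeparatedSet ε A).Finite := by
    rw [← Set.encard_ne_top_iff, encard_maximalSeparatedSet htop]
    exact htop
  refine ⟨hfin.toFinset, hcard _ (by simpa using maximalSeparatedSet_subset)
    (by simpa using isSeparated_maximalSeparatedSet), fun u hu => ?_⟩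
  have hcov := isCover_iff_subset_iUnion_closedBall.1 (isCover_maximalSeparatedSet htop)
  have huA : u ∈ A := by simpa [A] using hu
  obtain ⟨v, hv, huv⟩ := Set.mem_iUnion₂.1 (hcov huA)
  exact ⟨v, by simpa using hv, by
    rw [← dist_eq_norm]
    exact mem_closedBall.1 huv⟩

/-- Moving from a point `q` of a ball in a unit direction, one reaches a sphere of twice the
radius. -/
lemma exists_norm_add_smul_eq {d : ℕ} {R : ℝ} (hR : 0 < R) {q w : Euc d} (hq : ‖q‖ ≤ R)
    (hw : ‖w‖ = 1) : ∃ s, R ≤ s ∧ ‖q + s • w‖ = 2 * R := by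
  have hcont : ContinuousOn (fun s : ℝ => ‖q + s • w‖) (Icc 0 (3 * R)) := by fun_prop
  have h3 : 2 * R ≤ ‖q + (3 * R) • w‖ := by
    have := norm_sub_norm_le ((3 * R) • w) (-q)
    rw [norm_smul, hw, norm_neg, Real.norm_of_nonneg (by positivity), sub_neg_eq_add,
      add_comm] at this
    linarith
  obtain ⟨s, hs, hsR⟩ := intermediate_value_Icc (by positivity) hcont
    (show 2 * R ∈ Icc _ _ from ⟨by simp; linarith, h3⟩)
  refine ⟨s, ?_, hsR⟩
  have := norm_add_le q (s • w)
  rw [norm_smul, hw, Real.norm_of_nonneg hs.1, mul_one] at this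
  have h2 : ‖q + s • w‖ = 2 * R := hsR
  linarith

/-- If the outer point `u` of a boundary point `q` in direction `w` is close to `v`, then the
projection `p` of `v` is almost as high as `q` in direction `w`. -/
lemma inner_sub_le_of_near_projection {d : ℕ} {R h s : ℝ} (hR : 0 < R) (hs : R ≤ s)
    {q w p v : Euc d} (hqw : ⟪w, p - q⟫ ≤ 0)
    (hp : ⟪v - p, q - p⟫ ≤ 0) (hv : ‖q + s • w - v‖ ≤ h) :
    ⟪w, q - p⟫ ≤ 2 * h ^ 2 / R := by
  have hh : 0 ≤ h := (norm_nonneg _).trans hv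
  set a := q - p with ha
  set e := q + s • w - v with he
  have hpq : p - q = -a := by rw [ha]; abel
  have hvp : v - p = a + s • w - e := by rw [ha, he]; abel
  rw [hpq, inner_neg_right] at hqw
  rw [hvp, inner_sub_left, inner_add_left, real_inner_self_eq_norm_sq, inner_smul_left] at hp
  have hs' : (starRingEnd ℝ) s = s := rfl
  rw [hs'] at hp
  have hcs := real_inner_le_norm e a
  have hwa : 0 ≤ ⟪w, a⟫ := by linarith
  have hprod : 0 ≤ s * ⟪w, a⟫ := mul_nonneg (by linarith) hwa
  have ha' : ‖a‖ ≤ h := by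
    by_contra! hlt
    have : ‖e‖ * ‖a‖ ≤ h * ‖a‖ := by gcongr
    nlinarith [norm_nonneg a]
  have h1 : s * ⟪w, a⟫ ≤ h * h := by
    have : ‖e‖ * ‖a‖ ≤ h * h := by gcongr
    nlinarith [sq_nonneg ‖a‖]
  rw [le_div_iff₀ hR]
  nlinarith [mul_le_mul_of_nonneg_right hs hwa]

/-- A convex hull of points in a ball has few points whose projections have nearly the same
support function. -/
lemma exists_finset_support_approx {d : ℕ} (hd : 1 ≤ d) {R h : ℝ} (hh : 0 < h)
    (hR : h ≤ R) {K : Set (Euc d)} (hK : IsCompact K) (hconv : Convex ℝ K) (hne : K.Nonempty)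
    (hKR : ∀ x ∈ K, ‖x‖ ≤ R) :
    ∃ P : Finset (Euc d), (P : Set (Euc d)) ⊆ K ∧
      (P.card : ℝ) * h ^ (d - 1) ≤ 2 ^ d * d * (4 * R) ^ (d - 1) ∧
      ∀ w : Euc d, ‖w‖ = 1 → ∃ q ∈ K, (∀ x ∈ K, ⟪w, x⟫ ≤ ⟪w, q⟫) ∧
        ∃ p ∈ P, ⟪w, q - p⟫ ≤ 2 * h ^ 2 / R := by
  classical
  have hR0 : 0 < R := hh.trans_le hR
  obtain ⟨U, hUcard, hU⟩ := exists_sphere_net hd hh (show h ≤ 2 * R by linarith)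
  have hproj : ∀ v : Euc d, ∃ p ∈ K, ∀ x ∈ K, ⟪v - p, x - p⟫ ≤ 0 := fun v => by
    obtain ⟨p, hp, hpv⟩ := exists_norm_eq_iInf_of_complete_convex hne hK.isComplete hconv v
    exact ⟨p, hp, (norm_eq_iInf_iff_real_inner_le_zero hconv hp).1 hpv⟩
  choose π hπK hπ using hproj
  refine ⟨U.image π, ?_, ?_, fun w hw => ?_⟩
  · simp only [Finset.coe_image]
    rintro _ ⟨v, -, rfl⟩
    exact hπK v
  · rw [show 4 * R = 2 * (2 * R) by ring]
    refine le_trans ?_ hUcard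
    have hc : ((U.image π).card : ℝ) ≤ U.card := by exact_mod_cast Finset.card_image_le
    exact mul_le_mul_of_nonneg_right hc (by positivity)
  · obtain ⟨q, hqK, hq⟩ := hK.exists_isMaxOn hne
      (show ContinuousOn (fun x => ⟪w, x⟫) K by fun_prop)
    have hq' : ∀ x ∈ K, ⟪w, x⟫ ≤ ⟪w, q⟫ := fun x hx => hq hx
    obtain ⟨s, hs, hsR⟩ := exists_norm_add_smul_eq hR0 (hKR q hqK) hw
    obtain ⟨v, hvU, hv⟩ := hU _ hsR
    refine ⟨q, hqK, hq', π v, Finset.mem_image_of_mem π hvU,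
      inner_sub_le_of_near_projection hR0 hs ?_ (hπ v q hqK) hv⟩
    rw [inner_sub_right]
    linarith [hq' _ (hπK v)]

/-- Finitely many points of a convex hull lie in the convex hull of few of the generators. -/
lemma exists_finset_subset_convexHull_image {d n : ℕ} (S : Fin n → Euc d) (P : Finset (Euc d))
    (hP : (P : Set (Euc d)) ⊆ convexHull ℝ (range S)) :
    ∃ J : Finset (Fin n), J.card ≤ (d + 1) * P.card ∧
      (P : Set (Euc d)) ⊆ convexHull ℝ (S '' J) := by
  classical
  have h1 : ∀ p ∈ P, ∃ J : Finset (Fin n), J.card ≤ d + 1 ∧ p ∈ convexHull ℝ (S '' J) := by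
    intro p hp
    have hp' := hP hp
    rw [convexHull_eq_union] at hp'
    simp only [mem_iUnion] at hp'
    obtain ⟨t, hts, hind, hpt⟩ := hp'
    obtain ⟨J, hJ, hcard⟩ : ∃ J : Finset (Fin n), J.image S = t ∧ J.card = t.card := by
      obtain ⟨J, -, h1, h2⟩ := Finset.exists_subset_injOn_image_eq_of_surjOn (f := S) Set.univ t
        (fun x hx => by simpa using hts hx)
      exact ⟨J, h2, by rw [← h2, Finset.card_image_of_injOn h1]⟩
    refine ⟨J, ?_, ?_⟩
    · rw [hcard]
      simpa using hind.card_le_finrank_succ.trans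
        (Nat.succ_le_succ (Submodule.finrank_le _))
    · rwa [← Finset.coe_image, hJ]
  choose! J hJc hJ using h1
  refine ⟨P.biUnion J, ?_, fun p hp => ?_⟩
  · rw [mul_comm]
    exact Finset.card_biUnion_le_card_mul _ _ _ hJc
  · refine convexHull_mono (image_mono ?_) (hJ p hp)
    exact_mod_cast Finset.subset_biUnion_of_mem J hp

/-- A polytope containing a ball is covered by a slight dilation of the hull of few of its
generators. -/
lemma exists_few_generators_dilation {d : ℕ} (hd : 1 ≤ d) {R r : ℝ} (hr : 0 < r) (hrR : r ≤ R) :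
    ∃ C : ℝ, 0 < C ∧ ∀ δ : ℝ, 0 < δ → δ ≤ 1 → ∀ (n : ℕ) (S : Fin n → Euc d) (c : Euc d),
      (∀ i, ‖S i‖ ≤ R) → closedBall c r ⊆ convexHull ℝ (range S) →
      ∃ J : Finset (Fin n), (J.card : ℝ) * Real.sqrt δ ^ (d - 1) ≤ C ∧
        ∀ i, c + (1 + δ)⁻¹ • (S i - c) ∈ convexHull ℝ (S '' J) := by
  have hR : 0 < R := hr.trans_le hrR
  refine ⟨(d + 1) * (2 ^ d * d * (4 * R) ^ (d - 1)) / (r / 2) ^ (d - 1), by positivity, ?_⟩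
  intro δ hδ hδ1 n S c hS hc
  set h := r / 2 * Real.sqrt δ with hhdef
  have hh : 0 < h := by positivity
  have hsq1 : Real.sqrt δ ≤ 1 := Real.sqrt_le_one.2 hδ1
  have hhR : h ≤ R := by
    have : h ≤ r / 2 * 1 := by rw [hhdef]; gcongr
    linarith
  have hh2 : h ^ 2 = r ^ 2 * δ / 4 := by
    rw [hhdef, mul_pow, Real.sq_sqrt hδ.le]; ring
  obtain ⟨P, hPK, hPcard, hP⟩ := exists_finset_support_approx hd hh hhR
    ((finite_range S).isCompact_convexHull ℝ) (convex_convexHull ℝ _)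
    ⟨c, hc (mem_closedBall_self hr.le)⟩ (fun x hx => by
      have : convexHull ℝ (range S) ⊆ closedBall 0 R :=
        convexHull_min (by rintro _ ⟨i, rfl⟩; simpa using hS i) (convex_closedBall _ _)
      simpa using this hx)
  obtain ⟨J, hJcard, hJ⟩ := exists_finset_subset_convexHull_image S P hPK
  refine ⟨J, ?_, fun i => ?_⟩
  · rw [le_div_iff₀ (by positivity), mul_assoc, mul_comm (Real.sqrt δ ^ _), ← mul_pow]
    calc (J.card : ℝ) * h ^ (d - 1) ≤ ((d + 1) * P.card) * h ^ (d - 1) := by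
          gcongr; exact_mod_cast hJcard
      _ = (d + 1) * (P.card * h ^ (d - 1)) := by ring
      _ ≤ _ := by gcongr
  · by_contra hnot
    obtain ⟨f, u, hf1, hf2⟩ := geometric_hahn_banach_closed_point (convex_convexHull ℝ _)
      ((J.finite_toSet.image S).isClosed_convexHull ℝ) hnot
    set y := (InnerProductSpace.toDual ℝ (Euc d)).symm f
    have hy : ∀ x, f x = ⟪y, x⟫ := fun x => by simp [y]
    obtain ⟨p₀, hp₀⟩ : P.Nonempty := by
      obtain ⟨_, _, _, p, hp, _⟩ := hP (EuclideanSpace.single ⟨0, hd⟩ 1) (by simp)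
      exact ⟨p, hp⟩
    have hy0 : y ≠ 0 := fun h0 => by
      have := (hf1 _ (hJ hp₀)).trans hf2
      simp [hy, h0] at this
    have hny : 0 < ‖y‖ := norm_pos_iff.2 hy0
    obtain ⟨w, hw1, hyw⟩ : ∃ w : Euc d, ‖w‖ = 1 ∧ y = ‖y‖ • w :=
      ⟨‖y‖⁻¹ • y, by simp [norm_smul, hny.ne'], by simp [smul_smul, hny.ne']⟩
    obtain ⟨q, hqK, hq, p, hpP, hqp⟩ := hP w hw1
    have hlt := (hf1 _ (hJ hpP)).trans hf2
    rw [hy, hy, hyw, real_inner_smul_left, real_inner_smul_left] at hlt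
    replace hlt := lt_of_mul_lt_mul_left hlt hny.le
    have hSq := hq _ (subset_convexHull ℝ _ (mem_range_self i))
    have hball : ⟪w, c⟫ + r ≤ ⟪w, q⟫ := by
      have := hq (c + r • w) (hc (by simp [norm_smul, hw1, abs_of_pos hr]))
      rwa [inner_add_right, inner_smul_right, real_inner_self_eq_norm_sq, hw1, one_pow,
        mul_one] at this
    rw [inner_add_right, inner_smul_right, inner_sub_right] at hlt
    rw [inner_sub_right, hh2] at hqp
    have hqp' : ⟪w, q⟫ - ⟪w, p⟫ ≤ r * δ / 2 := by
      refine hqp.trans ?_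
      rw [div_le_iff₀ hR]
      nlinarith [mul_pos hr hδ]
    have h1δ : 0 < 1 + δ := by linarith
    have h2 : (1 + δ) * (⟪w, p⟫ - ⟪w, c⟫) < ⟪w, S i⟫ - ⟪w, c⟫ := by
      have : ⟪w, p⟫ - ⟪w, c⟫ < (1 + δ)⁻¹ * (⟪w, S i⟫ - ⟪w, c⟫) := by linarith
      rwa [inv_mul_eq_div, lt_div_iff₀ h1δ, mul_comm] at this
    nlinarith [mul_pos hr hδ, mul_le_mul_of_nonneg_left hδ1 (mul_pos hr hδ).le]

/-- Any convex body can be brought by an affine map into a position where it contains the standard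
simplex and is contained in the cube `[-1, 1]^d`. -/
lemma exists_simplex_position {d : ℕ} {G : Set (Euc d)} (hG : IsConvexBody G) :
    ∃ (L : Euc d ≃ₗ[ℝ] Euc d) (p : Euc d), p ∈ G ∧
      (∀ i, p + L.symm (EuclideanSpace.single i 1) ∈ G) ∧
      ∀ x ∈ G, ∀ i, |L (x - p) i| ≤ 1 := by
  classical
  obtain ⟨hcpt, -, p, hp⟩ := hG
  set e := (EuclideanSpace.basisFun (Fin d) ℝ).toBasis with he
  set D : Set (Fin d → Euc d) := Set.univ.pi fun _ => (fun x => p + x) ⁻¹' G with hD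
  have hDcpt : IsCompact D := isCompact_univ_pi fun _ =>
    (Homeomorph.addLeft p).isClosedEmbedding.isCompact_preimage hcpt
  have hdet : Continuous fun v : Fin d → Euc d => |e.det v| := by
    have : (fun v : Fin d → Euc d => |e.det v|) =
        fun v => |Matrix.det (Matrix.of fun i j => v j i)| := by
      ext v
      rw [Module.Basis.det_apply]
      congr 2
    rw [this]
    refine (Continuous.matrix_det ?_).abs
    exact continuous_matrix fun i j => by simp only [Matrix.of_apply]; fun_prop
  obtain ⟨v₀, hv₀D, hv₀⟩ : ∃ v ∈ D, e.det v ≠ 0 := by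
    obtain ⟨t, ht, hball⟩ := Metric.isOpen_iff.1 isOpen_interior p hp
    refine ⟨fun i => (t / 2) • e i, fun i _ => show _ ∈ G from interior_subset (hball ?_), ?_⟩
    · have : ‖e i‖ = 1 := by simp [he]
      simp [norm_smul, this, abs_of_pos ht, ht]
    · have := e.det.map_smul_univ (fun _ => t / 2) e
      rw [this, e.det_self]
      simp [ht.ne']
  obtain ⟨v, hvD, hv⟩ := hDcpt.exists_isMaxOn ⟨v₀, hv₀D⟩ hdet.continuousOn
  have hvpos : 0 < |e.det v| := (abs_pos.2 hv₀).trans_le (hv hv₀D)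
  have hunit : IsUnit (e.det v) := isUnit_iff_ne_zero.2 (abs_pos.1 hvpos)
  obtain ⟨hli, hsp⟩ := e.is_basis_iff_det.2 hunit
  set b := Module.Basis.mk hli hsp.ge with hb
  set L : Euc d ≃ₗ[ℝ] Euc d := b.equivFun.trans (WithLp.linearEquiv 2 ℝ (Fin d → ℝ)).symm
  refine ⟨L, p, interior_subset hp, fun i => ?_, fun x hx i => ?_⟩
  · have : L.symm (EuclideanSpace.single i 1) = v i := by
      rw [LinearEquiv.symm_apply_eq]
      ext j
      have hbi : v i = b i := by simp [hb]
      simp [L, hbi, Finsupp.single_apply, eq_comm]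
    rw [this]
    exact hvD i trivial
  · have hcoord : e.det v * L (x - p) i = e.det (Function.update v i (x - p)) := by
      have := LinearMap.congr_fun (e.det_smul_mk_coord_eq_det_update hli hsp.ge i) (x - p)
      simpa [L, hb] using this
    have hmem : Function.update v i (x - p) ∈ D := by
      intro j _
      rcases eq_or_ne j i with rfl | hj
      · simpa using hx
      · simpa [hj] using hvD j trivial
    have hle : |e.det (Function.update v i (x - p))| ≤ |e.det v| := hv hmem
    rw [← hcoord, abs_mul] at hle
    exact le_of_mul_le_mul_left (by simpa using hle) hvpos

/-- Points close to the vertices of the standard simplex have a convex hull which contains a ball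
around the centroid. -/
lemma closedBall_subset_convexHull_near_simplex {d : ℕ} {η : ℝ} (hη : 0 ≤ η)
    (hηd : η * (2 * (d + 1) ^ 2) ≤ 1) (a : Option (Fin d) → Euc d) (ha0 : ‖a none‖ ≤ η)
    (ha : ∀ i, ‖a (some i) - EuclideanSpace.single i 1‖ ≤ η) :
    closedBall (((d : ℝ) + 1)⁻¹ • ∑ i, EuclideanSpace.single i (1 : ℝ)) η ⊆
      convexHull ℝ (range a) := by
  intro z hz
  set c : Euc d := ((d : ℝ) + 1)⁻¹ • ∑ i, EuclideanSpace.single i (1 : ℝ) with hc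
  by_contra hnot
  obtain ⟨f, u, hf1, hf2⟩ := geometric_hahn_banach_closed_point (convex_convexHull ℝ _)
    ((finite_range a).isClosed_convexHull ℝ) hnot
  set y := (InnerProductSpace.toDual ℝ (Euc d)).symm f
  have hy : ∀ x, f x = ⟪y, x⟫ := fun x => by simp [y]
  have hlt : ∀ o, ⟪y, a o⟫ < ⟪y, z⟫ := fun o => by
    rw [← hy, ← hy]
    exact (hf1 _ (subset_convexHull ℝ _ (mem_range_self o))).trans hf2
  set N := ‖y‖
  have hclose : ∀ x x' : Euc d, ‖x - x'‖ ≤ η → ⟪y, x⟫ ≤ ⟪y, x'⟫ + N * η := fun x x' hx => by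
    have h1 := real_inner_le_norm y (x - x')
    have h2 : N * ‖x - x'‖ ≤ N * η := by gcongr
    rw [inner_sub_right] at h1
    linarith
  have hye : ∀ i, ⟪y, EuclideanSpace.single i (1 : ℝ)⟫ = y i := fun i => by
    simp [EuclideanSpace.inner_single_right]
  set m := ((d : ℝ) + 1)⁻¹ * ∑ i, y i with hm
  have hyc : ⟪y, c⟫ = m := by
    rw [hc, inner_smul_right, inner_sum, hm]
    simp only [hye]
  have hsum : ∑ i, y i = ((d : ℝ) + 1) * m := by rw [hm]; field_simp
  have hzc : ⟪y, z⟫ ≤ m + N * η := by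
    rw [← hyc]
    exact hclose z c (by simpa [dist_eq_norm] using hz)
  have h0 : 0 < m + 2 * (N * η) := by
    have := hclose 0 (a none) (by simpa using ha0)
    rw [inner_zero_right] at this
    linarith [hlt none]
  have hi : ∀ i, y i < m + 2 * (N * η) := fun i => by
    have := hclose _ (a (some i)) (by rw [norm_sub_rev]; exact ha i)
    rw [hye] at this
    linarith [hlt (some i)]
  have hN : 0 ≤ N * η := mul_nonneg (norm_nonneg _) hη
  have hm2 : m ≤ 2 * d * (N * η) := by
    have : ∑ i, y i ≤ ∑ _i : Fin d, (m + 2 * (N * η)) := Finset.sum_le_sum fun i _ => (hi i).le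
    rw [hsum, Finset.sum_const, Finset.card_univ, Fintype.card_fin, nsmul_eq_mul] at this
    linarith
  have hub : ∀ i, y i ≤ 2 * (d + 1) * (N * η) := fun i => by linarith [hi i]
  have hlb : ∀ i, -(2 * (d + 1) * (N * η)) ≤ y i := fun i => by
    have h1 : ∑ j ∈ Finset.univ.erase i, y j ≤
        ∑ _j ∈ Finset.univ.erase i, (m + 2 * (N * η)) := Finset.sum_le_sum fun j _ => (hi j).le
    have h2 := Finset.add_sum_erase Finset.univ (fun j => y j) (Finset.mem_univ i)
    have hd : 1 ≤ d := by have := i.isLt; omega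
    rw [Finset.sum_const, Finset.card_erase_of_mem (Finset.mem_univ i), Finset.card_univ,
      Fintype.card_fin, nsmul_eq_mul, Nat.cast_sub hd, Nat.cast_one] at h1
    simp only at h2
    linarith
  have hsq : N ^ 2 ≤ d * (2 * (d + 1) * (N * η)) ^ 2 := by
    rw [EuclideanSpace.real_norm_sq_eq]
    calc ∑ i, y i ^ 2 ≤ ∑ _i : Fin d, (2 * (d + 1) * (N * η)) ^ 2 :=
          Finset.sum_le_sum fun i _ => sq_le_sq' (hlb i) (hub i)
      _ = _ := by simp
  have hNpos : 0 < N := by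
    rcases (norm_nonneg y).eq_or_lt with h | h
    · have : N = 0 := h.symm
      have hy0 : y = 0 := norm_eq_zero.1 this
      have := hlt none
      simp [hy0] at this
    · exact h
  have hb : ((d : ℝ) + 1) * (2 * (d + 1) * (N * η)) ≤ N := by
    nlinarith
  have hb2 := pow_le_pow_left₀ (by positivity) hb 2
  have hd0 : (0 : ℝ) ≤ d := Nat.cast_nonneg d
  have : ((d : ℝ) + 1) ^ 2 * N ^ 2 ≤ d * N ^ 2 := by
    rw [mul_pow] at hb2
    nlinarith [sq_nonneg ((d : ℝ) + 1)]
  nlinarith [mul_pos hNpos hNpos]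

/-- Affine-invariant form of the approximation of random polytopes by the hull of few vertices:
the polytope only has to meet `d + 1` regions of fixed proportion of the body. -/
lemma exists_regions_few_generators {d : ℕ} (hd : 1 ≤ d) :
    ∃ C ρ : ℝ, 0 < C ∧ 0 < ρ ∧ ∀ G : Set (Euc d), IsConvexBody G →
      ∃ (A : Option (Fin d) → Set (Euc d)) (c : Euc d),
        (∀ o, MeasurableSet (A o) ∧ A o ⊆ G ∧
          volume (A o) = ENNReal.ofReal (ρ ^ d) * volume G) ∧
        ∀ δ : ℝ, 0 < δ → δ ≤ 1 → ∀ (n : ℕ) (ω : Fin n → Euc d), (∀ i, ω i ∈ G) →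
          (∀ o, ∃ i, ω i ∈ A o) →
          ∃ J : Finset (Fin n), (J.card : ℝ) * Real.sqrt δ ^ (d - 1) ≤ C ∧
            ∀ i, c + (1 + δ)⁻¹ • (ω i - c) ∈ convexHull ℝ (ω '' J) := by
  classical
  have hd1 : (1 : ℝ) ≤ d := by exact_mod_cast hd
  set η : ℝ := 1 / (2 * ((d : ℝ) + 1) ^ 2) with hη
  have hη0 : 0 < η := by positivity
  have hη1 : η ≤ 1 := by
    rw [hη, div_le_one (by positivity)]
    nlinarith
  obtain ⟨C, hC, hCJ⟩ := exists_few_generators_dilation hd hη0 (hη1.trans hd1)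
  set ρ : ℝ := η / (2 * d)
  have hρ0 : 0 < ρ := by positivity
  have hρ1 : ρ ≤ 1 := by
    rw [div_le_one (by positivity)]
    linarith
  refine ⟨C, ρ, hC, hρ0, fun G hG => ?_⟩
  obtain ⟨L, p, hpG, hpi, hL⟩ := exists_simplex_position hG
  obtain ⟨hcpt, hconv, -⟩ := hG
  set P : Option (Fin d) → Euc d := fun o =>
    p + L.symm (o.elim 0 fun i => EuclideanSpace.single i 1)
  have hPG : ∀ o, P o ∈ G := by
    rintro (_ | i)
    · simpa [P] using hpG
    · simpa [P] using hpi i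
  have hnorm : ∀ x ∈ G, ‖L (x - p)‖ ≤ d := fun x hx => by
    refine abs_le_of_sq_le_sq' ?_ (by positivity) |>.2
    rw [EuclideanSpace.real_norm_sq_eq]
    calc ∑ i, L (x - p) i ^ 2 ≤ ∑ _i : Fin d, (1 : ℝ) :=
          Finset.sum_le_sum fun i _ => (sq_le_one_iff_abs_le_one _).2 (hL x hx i)
      _ ≤ (d : ℝ) ^ 2 := by simp; nlinarith
  set c₀ : Euc d := ((d : ℝ) + 1)⁻¹ • ∑ i, EuclideanSpace.single i (1 : ℝ)
  refine ⟨fun o => AffineMap.homothety (P o) ρ '' G, p + L.symm c₀, fun o => ⟨?_, ?_, ?_⟩, ?_⟩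
  · exact (hcpt.image (AffineMap.homothety_continuous (P o) ρ)).measurableSet
  · rintro _ ⟨x, hx, rfl⟩
    rw [AffineMap.homothety_eq_lineMap]
    exact hconv.lineMap_mem (hPG o) hx ⟨hρ0.le, hρ1⟩
  · rw [Measure.addHaar_image_homothety, abs_of_pos (by positivity), finrank_euclideanSpace_fin]
  · intro δ hδ hδ1 n ω hω hA
    choose j hj using hA
    set S : Fin n → Euc d := fun i => L (ω i - p) with hS
    have hnear : ∀ o, ‖S (j o) - o.elim 0 fun i => EuclideanSpace.single i 1‖ ≤ η := fun o => by
      obtain ⟨x, hx, hxj⟩ := hj o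
      have h1 : S (j o) - (o.elim 0 fun i => EuclideanSpace.single i 1) =
          ρ • (L (x - p) - L (P o - p)) := by
        rw [← map_sub, ← map_smul]
        have : ω (j o) = ρ • (x - P o) + P o := by
          rw [← hxj, AffineMap.homothety_apply]; rfl
        rw [hS]
        simp only [this]
        rw [show ρ • (x - P o) + P o - p = ρ • (x - P o) + (P o - p) by abel, map_add,
          show x - p - (P o - p) = x - P o by abel]
        simp [P]
      rw [h1, norm_smul, Real.norm_of_nonneg hρ0.le]
      calc ρ * ‖L (x - p) - L (P o - p)‖ ≤ ρ * (d + d) := by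
            gcongr
            exact (norm_sub_le _ _).trans (add_le_add (hnorm x hx) (hnorm _ (hPG o)))
        _ = η := by simp only [ρ]; field_simp; ring
    have hball : closedBall c₀ η ⊆ convexHull ℝ (range S) := by
      refine (closedBall_subset_convexHull_near_simplex hη0.le ?_ (fun o => S (j o))
        (by simpa using hnear none) fun i => by simpa using hnear (some i)).trans
        (convexHull_mono ?_)
      · rw [hη]; field_simp; rfl
      · rintro _ ⟨o, rfl⟩
        exact mem_range_self _
    obtain ⟨J, hJc, hJ⟩ := hCJ δ hδ hδ1 n S c₀ (fun i => hnorm _ (hω i)) hball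
    refine ⟨J, hJc, fun i => ?_⟩
    set T : Euc d →ᵃ[ℝ] Euc d :=
      L.symm.toLinearMap.toAffineMap + AffineMap.const ℝ (Euc d) p
    have hTapp : ∀ x, T x = L.symm x + p := fun x => by simp [T]
    have hTS : ∀ i, T (S i) = ω i := fun i => by simp [hTapp, S]
    have himg : T '' convexHull ℝ (S '' J) = convexHull ℝ (ω '' J) := by
      rw [AffineMap.image_convexHull, image_image]
      simp only [hTS]
    rw [← himg]
    refine ⟨_, hJ i, ?_⟩
    clear_value c₀
    rw [hTapp, map_add, map_smul, map_sub]
    have : L.symm (S i) = ω i - p := by simp [S]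
    rw [this, show ω i - (p + L.symm c₀) = ω i - p - L.symm c₀ by abel]
    abel

/-- Membership in the convex hull of finitely many points is a closed condition. -/
lemma isClosed_mem_convexHull_range {d : ℕ} (ι : Type*) [Fintype ι] :
    IsClosed {q : (ι → Euc d) × Euc d | q.2 ∈ convexHull ℝ (range q.1)} := by
  classical
  have hmem : ∀ (y : ι → Euc d) (z : Euc d),
      z ∈ convexHull ℝ (range y) ↔ ∃ w : stdSimplex ℝ ι, z = ∑ i, w.1 i • y i := by
    intro y z
    have h1 : convexHull ℝ (range y) = Fintype.linearCombination ℝ y '' stdSimplex ℝ ι := by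
      rw [← convexHull_basis_eq_stdSimplex, LinearMap.image_convexHull, ← range_comp]
      congr 2
      ext1 i
      simp [Fintype.linearCombination_apply]
    rw [h1]
    constructor
    · rintro ⟨w, hw, rfl⟩
      exact ⟨⟨w, hw⟩, rfl⟩
    · rintro ⟨w, rfl⟩
      exact ⟨w.1, w.2, rfl⟩
  have hclosed : IsClosed {t : stdSimplex ℝ ι × ((ι → Euc d) × Euc d) |
      t.2.2 = ∑ i, t.1.1 i • t.2.1 i} := by
    refine isClosed_eq (by fun_prop) (continuous_finsetSum _ fun i _ => ?_)
    exact ((continuous_apply i).comp (continuous_subtype_val.comp continuous_fst)).smul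
      ((continuous_apply i).comp (continuous_fst.comp continuous_snd))
  have : CompactSpace (stdSimplex ℝ ι) := isCompact_iff_compactSpace.1 (isCompact_stdSimplex ℝ ι)
  convert isClosedMap_snd_of_compactSpace _ hclosed using 1
  ext ⟨y, z⟩
  simp only [mem_ofPred_eq, mem_image, Prod.exists, exists_eq_right, hmem]

/-- If a random set built from the points indexed by `T` has measure at most `b`, then it contains
the remaining `n - |T|` independent points with probability at most `b ^ (n - |T|)`. -/
lemma measure_remaining_points_mem_le {X : Type*} [MeasurableSpace X] (μ : Measure X)
    [IsProbabilityMeasure μ] {n : ℕ} (T : Finset (Fin n)) {H : Set (({i // i ∈ T} → X) × X)}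
    (hH : MeasurableSet H) (b : ℝ≥0∞) :
    MeasurableSet {ω : Fin n → X | μ {x | ((fun i : {i // i ∈ T} => ω i), x) ∈ H} ≤ b ∧
        ∀ j ∉ T, ((fun i : {i // i ∈ T} => ω i), ω j) ∈ H} ∧
      Measure.pi (fun _ : Fin n => μ)
        {ω : Fin n → X | μ {x | ((fun i : {i // i ∈ T} => ω i), x) ∈ H} ≤ b ∧
          ∀ j ∉ T, ((fun i : {i // i ∈ T} => ω i), ω j) ∈ H} ≤ b ^ (n - T.card) := by
  classical
  set F : Set (({i // i ∈ T} → X) × ({i // i ∉ T} → X)) :=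
    {q | μ {x | (q.1, x) ∈ H} ≤ b ∧ ∀ j, (q.1, q.2 j) ∈ H} with hF
  have hFm : MeasurableSet F := by
    have hFeq : F = {q | μ {x | (q.1, x) ∈ H} ≤ b} ∩ ⋂ j, {q | (q.1, q.2 j) ∈ H} := by
      ext q
      simp [hF]
    rw [hFeq]
    refine MeasurableSet.inter ?_ (MeasurableSet.iInter fun j => ?_)
    · exact measurableSet_le ((measurable_measure_prodMk_left hH).comp measurable_fst)
        measurable_const
    · exact (measurable_fst.prodMk ((measurable_pi_apply j).comp measurable_snd)) hH
  have hM := measurePreserving_piEquivPiSubtypeProd (fun _ : Fin n => μ) (fun i => i ∈ T)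
  have heq : {ω : Fin n → X | μ {x | ((fun i : {i // i ∈ T} => ω i), x) ∈ H} ≤ b ∧
      ∀ j ∉ T, ((fun i : {i // i ∈ T} => ω i), ω j) ∈ H} =
      MeasurableEquiv.piEquivPiSubtypeProd (fun _ : Fin n => X) (fun i => i ∈ T) ⁻¹' F := by
    ext ω
    exact and_congr_right fun _ => ⟨fun h j => h j.1 j.2, fun h j hj => h ⟨j, hj⟩⟩
  rw [heq]
  refine ⟨hM.measurable hFm, ?_⟩
  rw [hM.measure_preimage hFm.nullMeasurableSet, Measure.prod_apply hFm]
  have hsec : ∀ y : {i // i ∈ T} → X,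
      Measure.pi (fun _ : {i // i ∉ T} => μ) (Prod.mk y ⁻¹' F) ≤ b ^ (n - T.card) := by
    intro y
    by_cases hy : μ {x | (y, x) ∈ H} ≤ b
    · calc Measure.pi (fun _ : {i // i ∉ T} => μ) (Prod.mk y ⁻¹' F)
          ≤ Measure.pi (fun _ : {i // i ∉ T} => μ) (Set.univ.pi fun _ => {x | (y, x) ∈ H}) :=
            measure_mono fun z hz j _ => hz.2 j
        _ = μ {x | (y, x) ∈ H} ^ (n - T.card) := by
            rw [Measure.pi_pi, Finset.prod_const, Finset.card_univ, Fintype.card_subtype_compl,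
              Fintype.card_fin, Fintype.card_coe]
        _ ≤ _ := by gcongr
    · have : Prod.mk y ⁻¹' F = ∅ := by
        ext z
        simp only [mem_preimage, mem_empty_iff_false, iff_false]
        exact fun h => hy h.1
      simp [this]
  exact (lintegral_mono hsec).trans (by simp)

/-- Averaged union bound: if every point of `W` lies in `E T` for all supersets `T` of a set of at
most `k` indices, the union bound over subsets of size `k` can be replaced by an average over all
sets of indices. -/
lemma measure_mul_two_pow_le {Ω : Type*} [MeasurableSpace Ω] (P : Measure Ω) {n k : ℕ} (b : ℝ≥0∞)
    (E : Finset (Fin n) → Set Ω) (hEm : ∀ T, MeasurableSet (E T))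
    (hE : ∀ T, P (E T) ≤ b ^ (n - T.card)) (W : Set Ω)
    (hW : ∀ ω ∈ W, ∃ J : Finset (Fin n), J.card ≤ k ∧ ∀ T, J ⊆ T → ω ∈ E T) :
    2 ^ n * P W ≤ 2 ^ k * (1 + b) ^ n := by
  classical
  set f : Ω → ℝ≥0∞ := fun ω => ∑ T : Finset (Fin n), (E T).indicator 1 ω with hf
  have hfm : Measurable f :=
    Finset.measurable_sum _ fun T _ => measurable_one.indicator (hEm T)
  have hint : ∫⁻ ω, f ω ∂P ≤ (1 + b) ^ n := by
    calc ∫⁻ ω, f ω ∂P = ∑ T : Finset (Fin n), P (E T) := by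
          rw [lintegral_finsetSum _ fun T _ => measurable_one.indicator (hEm T)]
          exact Finset.sum_congr rfl fun T _ => lintegral_indicator_one (hEm T)
      _ ≤ ∑ T : Finset (Fin n), 1 ^ T.card * b ^ (n - T.card) :=
          Finset.sum_le_sum fun T _ => by simpa using hE T
      _ = _ := by simpa using Fintype.sum_pow_mul_eq_add_pow (Fin n) (1 : ℝ≥0∞) b
  have hWf : W ⊆ {ω | 2 ^ n ≤ 2 ^ k * f ω} := by
    intro ω hω
    obtain ⟨J, hJ, hJE⟩ := hW ω hω
    have h1 : (2 : ℝ≥0∞) ^ (n - J.card) ≤ f ω := by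
      calc (2 : ℝ≥0∞) ^ (n - J.card)
          = ∑ T ∈ Finset.Icc J Finset.univ, (E T).indicator 1 ω := by
            rw [Finset.sum_congr rfl (g := fun _ => (1 : ℝ≥0∞)) fun T hT => by
              simp [hJE T (Finset.mem_Icc.1 hT).1]]
            simp [Finset.card_Icc_finset (Finset.subset_univ J)]
        _ ≤ f ω := Finset.sum_le_sum_of_subset (Finset.subset_univ _)
    have hJn : J.card ≤ n := by simpa using J.card_le_univ
    calc (2 : ℝ≥0∞) ^ n = 2 ^ J.card * 2 ^ (n - J.card) := by
          rw [← pow_add, Nat.add_sub_cancel' hJn]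
      _ ≤ 2 ^ k * f ω := mul_le_mul' (pow_le_pow_right₀ one_le_two hJ) h1
  calc 2 ^ n * P W ≤ 2 ^ n * P {ω | 2 ^ n ≤ 2 ^ k * f ω} := by gcongr
    _ ≤ ∫⁻ ω, 2 ^ k * f ω ∂P := mul_meas_ge_le_lintegral (hfm.const_mul _) _
    _ = 2 ^ k * ∫⁻ ω, f ω ∂P := lintegral_const_mul _ hfm
    _ ≤ _ := by gcongr

/-- The uniform measure on a convex body is a probability measure. -/
lemma isProbabilityMeasure_unifMeasure {d : ℕ} {G : Set (Euc d)} (hG : IsConvexBody G) :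
    IsProbabilityMeasure (unifMeasure G) := by
  constructor
  rw [unifMeasure, Measure.smul_apply, Measure.restrict_apply_univ, smul_eq_mul]
  exact ENNReal.inv_mul_cancel (Measure.measure_pos_of_nonempty_interior _ hG.2.2).ne'
    hG.1.measure_lt_top.ne

/-- The choice `δ = n ^ (-2 / (d + 1))` balances the number of vertices with the missing volume. -/
lemma rpow_balance {d n : ℕ} (hd : 1 ≤ d) (hn : 1 ≤ n) :
    (n : ℝ) * (n : ℝ) ^ (-(2 : ℝ) / ((d : ℝ) + 1)) *
      Real.sqrt ((n : ℝ) ^ (-(2 : ℝ) / ((d : ℝ) + 1))) ^ (d - 1) = 1 := by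
  have hn0 : (0 : ℝ) < n := by exact_mod_cast hn
  have hd0 : (0 : ℝ) < (d : ℝ) + 1 := by positivity
  rw [Real.sqrt_eq_rpow, ← Real.rpow_mul hn0.le, ← Real.rpow_natCast, ← Real.rpow_mul hn0.le,
    Nat.cast_sub hd, Nat.cast_one]
  nth_rewrite 1 [← Real.rpow_one (n : ℝ)]
  rw [← Real.rpow_add hn0, ← Real.rpow_add hn0]
  convert Real.rpow_zero (n : ℝ) using 2
  field_simp
  ring

/-- The uniform measure of a dilated hull of sample points is controlled by the missing volume of
the full hull. -/
lemma unifMeasure_dilation_le {d : ℕ} {G K K' : Set (Euc d)} (hG : IsConvexBody G)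
    (hKG : K ⊆ G) (hK' : K' ⊆ K) (hKm : MeasurableSet K) {δ ε t : ℝ} (hδ : 0 ≤ δ) (hδ1 : δ ≤ 1)
    (c : Euc d) (hε : ε + d * 2 ^ (d - 1) * δ ≤ t)
    (ht : t ≤ (volume (G \ K)).toReal / (volume G).toReal) :
    unifMeasure G {z | c + (1 + δ)⁻¹ • (z - c) ∈ K'} ≤ ENNReal.ofReal (1 - ε) := by
  have hGpos : 0 < (volume G).toReal :=
    ENNReal.toReal_pos (Measure.measure_pos_of_nonempty_interior _ hG.2.2).ne'
      hG.1.measure_lt_top.ne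
  have hGtop : volume G ≠ ⊤ := hG.1.measure_lt_top.ne
  have hKtop : volume K ≠ ⊤ := ne_top_of_le_ne_top hGtop (measure_mono hKG)
  have h1δ : 0 < 1 + δ := by linarith
  have hsub : {z | c + (1 + δ)⁻¹ • (z - c) ∈ K'} ⊆ AffineMap.homothety c (1 + δ) '' K := by
    intro z hz
    refine ⟨_, hK' hz, ?_⟩
    rw [AffineMap.homothety_apply]
    simp [smul_smul, h1δ.ne']
  have hvol : volume (AffineMap.homothety c (1 + δ) '' K) =
      ENNReal.ofReal ((1 + δ) ^ d) * volume K := by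
    rw [Measure.addHaar_image_homothety, abs_of_pos (by positivity), finrank_euclideanSpace_fin]
  set v := (volume (G \ K)).toReal / (volume G).toReal with hv
  have hKv : (volume K).toReal = (1 - v) * (volume G).toReal := by
    have h1 := measureReal_sdiff_add_inter (μ := volume) (s := G) hKm hGtop
    rw [inter_eq_right.2 hKG] at h1
    simp only [Measure.real] at h1
    rw [hv]
    field_simp
    linarith
  have hv0 : 0 ≤ v := by positivity
  have hv1 : 0 ≤ 1 - v := by
    by_contra! h
    nlinarith [ENNReal.toReal_nonneg (a := volume K)]
  have hpow : (1 + δ) ^ d ≤ 1 + d * 2 ^ (d - 1) * δ := by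
    have h1 := (le_abs_self _).trans (abs_pow_sub_pow_le (1 + δ) 1 d)
    rw [one_pow, add_sub_cancel_left, abs_of_nonneg hδ, abs_of_pos h1δ, abs_one,
      max_eq_left (by linarith)] at h1
    have h2 : δ * d * (1 + δ) ^ (d - 1) ≤ δ * d * 2 ^ (d - 1) := by
      gcongr
      linarith
    linarith
  have hreal : (1 + δ) ^ d * (1 - v) ≤ 1 - ε := by
    have h0 : 0 ≤ d * 2 ^ (d - 1) * δ := by positivity
    nlinarith [mul_le_mul_of_nonneg_right hpow hv1, mul_nonneg h0 hv0]
  rw [unifMeasure, Measure.smul_apply, smul_eq_mul]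
  calc (volume G)⁻¹ * volume.restrict G {z | c + (1 + δ)⁻¹ • (z - c) ∈ K'}
      ≤ (volume G)⁻¹ * (ENNReal.ofReal ((1 + δ) ^ d) * volume K) := by
        gcongr
        rw [← hvol]
        exact (Measure.restrict_apply_le _ _).trans (measure_mono hsub)
    _ = ENNReal.ofReal ((1 + δ) ^ d * (1 - v)) := by
        rw [← ENNReal.ofReal_toReal hKtop, ← ENNReal.ofReal_toReal hGtop, hKv,
          ← ENNReal.ofReal_inv_of_pos hGpos, ← ENNReal.ofReal_mul (by positivity),
          ← ENNReal.ofReal_mul (by positivity)]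
        congr 1
        field_simp
    _ ≤ _ := ENNReal.ofReal_le_ofReal hreal

/-- The probability that a region `A` contains none of the `n` points is exponentially small. -/
lemma sampleMeasure_avoid_le {d n : ℕ} {G A : Set (Euc d)} (hG : IsConvexBody G)
    (hA : MeasurableSet A) (hAG : A ⊆ G) {θ : ℝ}
    (hvol : volume A = ENNReal.ofReal θ * volume G) :
    sampleMeasure G n {ω | ∀ i, ω i ∉ A} ≤ ENNReal.ofReal (Real.exp (-θ * n)) := by
  have := isProbabilityMeasure_unifMeasure hG
  have hmeas : unifMeasure G A = ENNReal.ofReal θ := by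
    rw [unifMeasure, Measure.smul_apply, Measure.restrict_apply hA, inter_eq_left.2 hAG, hvol,
      smul_eq_mul, mul_comm, mul_assoc, ENNReal.mul_inv_cancel
      (Measure.measure_pos_of_nonempty_interior _ hG.2.2).ne' hG.1.measure_lt_top.ne, mul_one]
  have hset : {ω : Fin n → Euc d | ∀ i, ω i ∉ A} = Set.univ.pi fun _ => Aᶜ := by
    ext ω
    simp
  rw [hset, sampleMeasure, Measure.pi_pi, Finset.prod_const, Finset.card_univ, Fintype.card_fin,
    prob_compl_eq_one_sub hA, hmeas, neg_mul, mul_comm, ← mul_neg, Real.exp_nat_mul,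
    ENNReal.ofReal_pow (Real.exp_pos _).le]
  gcongr
  rw [← ENNReal.ofReal_one, tsub_le_iff_right]
  refine (ENNReal.ofReal_le_ofReal ?_).trans ENNReal.ofReal_add_le
  linarith [Real.add_one_le_exp (-θ)]

/-- With few vertices needed, a large missing volume is exponentially unlikely. -/
lemma sampleMeasure_large_missing_le {d n k : ℕ} {G : Set (Euc d)} (hG : IsConvexBody G)
    {δ ε t : ℝ} (hδ : 0 ≤ δ) (hδ1 : δ ≤ 1) (hε : ε + d * 2 ^ (d - 1) * δ ≤ t) (hε1 : ε ≤ 1)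
    (c : Euc d) (W : Set (Fin n → Euc d)) (hWG : ∀ ω ∈ W, ∀ i, ω i ∈ G)
    (hWt : ∀ ω ∈ W,
      t ≤ (volume (G \ convexHull ℝ (range ω))).toReal / (volume G).toReal)
    (hWJ : ∀ ω ∈ W, ∃ J : Finset (Fin n), J.card ≤ k ∧
      ∀ i, c + (1 + δ)⁻¹ • (ω i - c) ∈ convexHull ℝ (ω '' J)) :
    sampleMeasure G n W ≤ ENNReal.ofReal (Real.exp (k - n * ε / 2)) := by
  classical
  have := isProbabilityMeasure_unifMeasure hG
  set H : (T : Finset (Fin n)) → Set (({i // i ∈ T} → Euc d) × Euc d) := fun T =>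
    {q | c + (1 + δ)⁻¹ • (q.2 - c) ∈ convexHull ℝ (range q.1)} with hH
  have hHm : ∀ T, MeasurableSet (H T) := fun T => by
    have hcont : Continuous fun q : ({i // i ∈ T} → Euc d) × Euc d =>
        (q.1, c + (1 + δ)⁻¹ • (q.2 - c)) := by fun_prop
    exact ((isClosed_mem_convexHull_range {i // i ∈ T}).preimage hcont).measurableSet
  have hrange : ∀ (T : Finset (Fin n)) (ω : Fin n → Euc d),
      range (fun i : {i // i ∈ T} => ω i) = ω '' T := fun T ω => by
    ext z
    simp
  have hET := fun T => measure_remaining_points_mem_le (unifMeasure G) T (hHm T)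
    (ENNReal.ofReal (1 - ε))
  have hmain := measure_mul_two_pow_le (sampleMeasure G n) (k := k) (ENNReal.ofReal (1 - ε)) _
    (fun T => (hET T).1) (fun T => (hET T).2) W ?_
  · have h2n : (2 : ℝ≥0∞) ^ n ≠ 0 := by positivity
    have h2n' : (2 : ℝ≥0∞) ^ n ≠ ⊤ := ENNReal.pow_ne_top (by simp)
    have hrhs : (2 : ℝ≥0∞) ^ k * (1 + ENNReal.ofReal (1 - ε)) ^ n =
        2 ^ n * ENNReal.ofReal (2 ^ k * (1 - ε / 2) ^ n) := by
      rw [← ENNReal.ofReal_one, ← ENNReal.ofReal_add zero_le_one (by linarith),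
        ← ENNReal.ofReal_ofNat 2, ← ENNReal.ofReal_pow (by norm_num),
        ← ENNReal.ofReal_pow (by linarith), ← ENNReal.ofReal_pow (by norm_num),
        ← ENNReal.ofReal_mul (by positivity), ← ENNReal.ofReal_mul (by positivity)]
      congr 1
      rw [show 1 + (1 - ε) = 2 * (1 - ε / 2) by ring, mul_pow]
      ring
    rw [hrhs, ENNReal.mul_le_mul_iff_right h2n h2n'] at hmain
    refine hmain.trans (ENNReal.ofReal_le_ofReal ?_)
    have h1 : (2 : ℝ) ^ k ≤ Real.exp k := by
      rw [← Real.exp_one_pow]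
      gcongr
      linarith [Real.add_one_le_exp 1]
    have h2 : (1 - ε / 2) ^ n ≤ Real.exp (-(n * ε / 2)) := by
      rw [show -(n * ε / 2) = n * (-(ε / 2)) by ring, Real.exp_nat_mul]
      have : 0 ≤ 1 - ε / 2 := by linarith
      gcongr
      exact Real.one_sub_le_exp_neg _
    rw [show (k : ℝ) - n * ε / 2 = k + -(n * ε / 2) by ring, Real.exp_add]
    have : 0 ≤ (1 - ε / 2) ^ n := pow_nonneg (by linarith) _
    gcongr
  · intro ω hω
    obtain ⟨J, hJ, hJω⟩ := hWJ ω hω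
    refine ⟨J, hJ, fun T hJT => ⟨?_, fun j _ => ?_⟩⟩
    · simp only [hH, mem_ofPred_eq, hrange]
      exact unifMeasure_dilation_le hG
        (convexHull_min (range_subset_iff.2 (hWG ω hω)) hG.2.1)
        (convexHull_mono (image_subset_range _ _))
        ((finite_range ω).isClosed_convexHull ℝ).measurableSet hδ hδ1 c hε (hWt ω hω)
    · simp only [hH, mem_ofPred_eq, hrange]
      exact convexHull_mono (image_mono (by exact_mod_cast hJT)) (hJω j)

/-- Deviation inequality for the convex hull of `n` i.i.d. uniform points in a convex body. -/
theorem convex_hull_deviation_inequality (d : ℕ) (hd : 1 ≤ d) :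
    ∃ a1 a2 a3 : ℝ, 0 < a1 ∧ 0 < a2 ∧ 0 < a3 ∧
      ∀ n : ℕ, 2 ≤ n →
        ∀ x : ℝ, 0 ≤ x →
          ∀ G : Set (Euc d), IsConvexBody G →
            ENNReal.ofReal (1 - a2 * Real.exp (-a3 * x)) ≤
              sampleMeasure G n
                {ω | (volume (G \ convexHull ℝ (Set.range ω))).toReal / (volume G).toReal ≤
                  a1 * (n : ℝ) ^ (-(2 : ℝ) / ((d : ℝ) + 1)) + x / (n : ℝ)} := by
  obtain ⟨C, ρ, hC, hρ, hregions⟩ := exists_regions_few_generators hd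
  refine ⟨d * 2 ^ (d - 1) + 2 * C, d + 2, min (1 / 2) (ρ ^ d), by positivity, by positivity,
    by positivity, fun n hn x hx G hG => ?_⟩
  obtain ⟨A, c, hA, hgen⟩ := hregions G hG
  have := isProbabilityMeasure_unifMeasure hG
  have hn0 : (0 : ℝ) < n := by positivity
  have hbalance := rpow_balance hd (one_le_two.trans hn)
  have hδ1 : (n : ℝ) ^ (-(2 : ℝ) / ((d : ℝ) + 1)) ≤ 1 :=
    Real.rpow_le_one_of_one_le_of_nonpos (by exact_mod_cast one_le_two.trans hn)
      (div_nonpos_of_nonpos_of_nonneg (by norm_num) (by positivity))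
  have hδ0 : 0 < (n : ℝ) ^ (-(2 : ℝ) / ((d : ℝ) + 1)) := Real.rpow_pos_of_pos hn0 _
  generalize (n : ℝ) ^ (-(2 : ℝ) / ((d : ℝ) + 1)) = δ at *
  set a := min (1 / 2) (ρ ^ d) with ha
  set t := (d * 2 ^ (d - 1) + 2 * C) * δ + x / n with ht
  set V : (Fin n → Euc d) → ℝ := fun ω =>
    (volume (G \ convexHull ℝ (range ω))).toReal / (volume G).toReal
  have huniv : sampleMeasure G n univ = 1 := by
    rw [sampleMeasure, measure_univ]
  rcases le_or_gt 1 t with ht1 | ht1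
  · have hS : {ω | V ω ≤ t} = univ := by
      refine eq_univ_of_forall fun ω => le_trans ?_ ht1
      exact div_le_one_of_le₀
        (ENNReal.toReal_mono hG.1.measure_lt_top.ne (measure_mono sdiff_subset))
        ENNReal.toReal_nonneg
    rw [hS, huniv, ← ENNReal.ofReal_one]
    refine ENNReal.ofReal_le_ofReal ?_
    have : 0 ≤ ((d : ℝ) + 2) * Real.exp (-a * x) := by positivity
    linarith
  have hxn : x ≤ n := by
    have h1 : 0 ≤ (d * 2 ^ (d - 1) + 2 * C) * δ := by positivity
    have h2 : x / n ≤ 1 := by linarith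
    rwa [div_le_one hn0] at h2
  set W : Set (Fin n → Euc d) := {ω | (∀ i, ω i ∈ G) ∧ (∀ o, ∃ i, ω i ∈ A o) ∧ t < V ω} with hW
  have hWle : sampleMeasure G n W ≤ ENNReal.ofReal (Real.exp (-a * x)) := by
    refine (sampleMeasure_large_missing_le (k := ⌊C * (n * δ)⌋₊) (ε := 2 * C * δ + x / n) (t := t)
      hG hδ0.le hδ1 ?_ ?_ c W (fun ω h => h.1) (fun ω h => h.2.2.le) fun ω h => ?_).trans
      (ENNReal.ofReal_le_ofReal (Real.exp_le_exp.2 ?_))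
    · rw [ht]
      linarith
    · have : 0 ≤ (d * 2 ^ (d - 1)) * δ := by positivity
      linarith
    · obtain ⟨J, hJ, hJω⟩ := hgen δ hδ0 hδ1 n ω h.1 h.2.1
      refine ⟨J, Nat.le_floor ?_, hJω⟩
      calc (J.card : ℝ) = (J.card * Real.sqrt δ ^ (d - 1)) * (n * δ) := by
            rw [mul_assoc, mul_comm (Real.sqrt δ ^ (d - 1)), hbalance, mul_one]
        _ ≤ _ := by gcongr
    · have h1 := Nat.floor_le (a := C * (n * δ)) (by positivity)
      have h2 : n * (2 * C * δ + x / n) / 2 = C * (n * δ) + x / 2 := by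
        field_simp
      have h3 : a * x ≤ 1 / 2 * x := by
        gcongr
        exact min_le_left _ _
      linarith
  have havoid : ∀ o, sampleMeasure G n {ω | ∀ i, ω i ∉ A o} ≤
      ENNReal.ofReal (Real.exp (-a * x)) := fun o => by
    refine (sampleMeasure_avoid_le hG (hA o).1 (hA o).2.1 (hA o).2.2).trans
      (ENNReal.ofReal_le_ofReal (Real.exp_le_exp.2 ?_))
    rw [neg_mul, neg_mul, neg_le_neg_iff]
    gcongr
    exact min_le_right _ _
  have hout : sampleMeasure G n {ω | ∃ i, ω i ∉ G} = 0 := by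
    rw [ofPred_exists]
    refine measure_iUnion_null fun i => ?_
    have hGc : unifMeasure G Gᶜ = 0 := by
      rw [unifMeasure, Measure.smul_apply, Measure.restrict_apply hG.1.measurableSet.compl,
        compl_inter_self, measure_empty, smul_zero]
    exact (measurePreserving_eval (fun _ : Fin n => unifMeasure G) i).quasiMeasurePreserving
      |>.preimage_null hGc
  have hcover : univ ⊆ {ω | V ω ≤ t} ∪
      (W ∪ ((⋃ o, {ω : Fin n → Euc d | ∀ i, ω i ∉ A o}) ∪ {ω | ∃ i, ω i ∉ G})) := by
    intro ω _
    by_contra h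
    simp only [mem_union, mem_iUnion, hW, mem_ofPred_eq] at h
    push Not at h
    exact h.2.1 h.2.2.2 h.2.2.1 |>.not_gt h.1
  rw [ENNReal.ofReal_sub _ (by positivity), tsub_le_iff_right, ENNReal.ofReal_one, ← huniv]
  refine (measure_mono hcover).trans ((measure_union_le _ _).trans (add_le_add le_rfl ?_))
  calc _ ≤ sampleMeasure G n W + ((∑ o, sampleMeasure G n {ω | ∀ i, ω i ∉ A o}) +
        sampleMeasure G n {ω | ∃ i, ω i ∉ G}) :=
        (measure_union_le _ _).trans (add_le_add le_rfl
          ((measure_union_le _ _).trans (add_le_add (measure_iUnion_fintype_le _ _) le_rfl)))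
    _ ≤ ENNReal.ofReal (Real.exp (-a * x)) +
        ((∑ _ : Option (Fin d), ENNReal.ofReal (Real.exp (-a * x))) + 0) :=
        add_le_add hWle (add_le_add (Finset.sum_le_sum fun o _ => havoid o) hout.le)
    _ = _ := by
        rw [ENNReal.ofReal_mul (by positivity), ENNReal.ofReal_add (by positivity) (by positivity),
          Finset.sum_const, Finset.card_univ, Fintype.card_option, Fintype.card_fin]
        simp only [nsmul_eq_mul, ENNReal.ofReal_natCast, ENNReal.ofReal_ofNat]
        push_cast
        ring
end
end
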